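/- arXiv:2501.18381 — 6 statements merged into one kernel-verified Lean document; each statement's English description precedes it below -/
import Mathlib

section
/- Let E be a finite-dimensional real inner product space, X ⊆ E a compact convex set of diameter at most D with D > 0, and fix η > 0, L ≥ 0, M ≥ 0 and a positive integer T. For t = 1,…,T let ℓ_t, ℓ̃_t : E → ℝ be differentiable functions that are convex on X, L-smooth on X, and satisfy ‖∇ℓ_t(x)‖ ≤ M and ‖∇ℓ̃_t(x)‖ ≤ M for all x ∈ X. Let ε_t > 0 satisfy ε_t ≤ (1/(8η))·((t+1)²·(15 + 8η²L² + 2η²M²/D²))⁻¹ for each t. Let x_1 ∈ X and let (x_t)_{t=1}^{T+1}, (x̃_t)_{t=1}^{T} be RIOD inexact iterates for the losses ℓ_t, hints ℓ̃_t, step η and tolerances ε_t. Then for every u ∈ X: ∑_{t=1}^{T} (ℓ_t(x̃_t) − ℓ_t(u)) ≤ 3D²/(2η) + η·∑_{t=1}^{T} ‖∇ℓ_t(x̃_t) − ∇ℓ̃_t(x̃_t)‖². -/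
open scoped RealInnerProductSpace Gradient

section ConvexDifferentiable

variable {E : Type*} [NormedAddCommGroup E] [InnerProductSpace ℝ E] [CompleteSpace E]

/-- First-order characterization of convexity: a convex function lies above its tangents. -/
theorem ConvexOn.add_inner_gradient_le {X : Set E} {f : E → ℝ} (hf : ConvexOn ℝ X f) {a b : E}
    (hfa : DifferentiableAt ℝ f a) (ha : a ∈ X) (hb : b ∈ X) :
    f a + ⟪∇ f a, b - a⟫ ≤ f b := by
  have hline : ConvexOn ℝ (AffineMap.lineMap (k := ℝ) a b ⁻¹' X)
      (f ∘ AffineMap.lineMap (k := ℝ) a b) := hf.comp_affineMap _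
  have hgrad : HasFDerivAt f (InnerProductSpace.toDual ℝ E (∇ f a))
      (AffineMap.lineMap (k := ℝ) a b 0) := by
    simpa using hfa.hasGradientAt.hasFDerivAt
  have hderiv := hgrad.comp_hasDerivAt (0 : ℝ) AffineMap.hasDerivAt_lineMap
  have hslope := hline.le_slope_of_hasDerivAt (x := 0) (y := 1) (by simpa using ha)
    (by simpa using hb) one_pos hderiv
  simp only [InnerProductSpace.toDual_apply_apply, slope_def_field, Function.comp_apply,
    AffineMap.lineMap_apply_one, AffineMap.lineMap_apply_zero, sub_zero, div_one] at hslope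
  linarith

/-- Variational inequality for a proximal step, in three-point form. -/
theorem IsMinOn.inner_gradient_prox_le {X : Set E} (hX : Convex ℝ X) {f : E → ℝ} {η : ℝ}
    (hη : 0 < η) {x z v : E} (hfz : DifferentiableAt ℝ f z)
    (hmin : IsMinOn (fun y => f y + 1 / (2 * η) * ‖y - x‖ ^ 2) X z) (hz : z ∈ X) (hv : v ∈ X) :
    η * ⟪∇ f z, z - v⟫ ≤ (‖v - x‖ ^ 2 - ‖z - x‖ ^ 2 - ‖v - z‖ ^ 2) / 2 := by
  have hsq : HasFDerivAt (fun y : E => ‖y - x‖ ^ 2) (2 • innerSL ℝ (z - x)) z := by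
    exact (hasStrictFDerivAt_norm_sq (z - x)).hasFDerivAt.comp z
      ((hasFDerivAt_id z).sub_const x)
  have hderiv := hfz.hasGradientAt.hasFDerivAt.add (hsq.const_mul (1 / (2 * η)))
  have hnonneg := hmin.localize.hasFDerivWithinAt_nonneg hderiv.hasFDerivWithinAt
    (sub_mem_posTangentConeAt_of_segment_subset (hX.segment_subset hz hv))
  have hexpand : ‖v - x‖ ^ 2 = ‖z - x‖ ^ 2 + 2 * ⟪z - x, v - z⟫ + ‖v - z‖ ^ 2 := by
    rw [← norm_add_sq_real]
    congr 2
    abel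
  have hinner : 0 ≤ ⟪∇ f z, v - z⟫ + 1 / (2 * η) * (2 * ⟪z - x, v - z⟫) := by
    simpa only [add_apply, smul_apply,
      InnerProductSpace.toDual_apply_apply, innerSL_apply_apply, smul_eq_mul, nsmul_eq_mul,
      Nat.cast_ofNat] using hnonneg
  have hscaled := mul_nonneg hη.le hinner
  have hcancel : η * (⟪∇ f z, v - z⟫ + 1 / (2 * η) * (2 * ⟪z - x, v - z⟫))
      = η * ⟪∇ f z, v - z⟫ + ⟪z - x, v - z⟫ := by
    field_simp
  have hneg : ⟪∇ f z, z - v⟫ = -⟪∇ f z, v - z⟫ := by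
    rw [← inner_neg_right, neg_sub]
  rw [hneg]
  linarith

/-- Quadratic growth of a proximal objective around its minimizer. -/
theorem ConvexOn.prox_quadratic_growth {X : Set E} {f : E → ℝ} (hf : ConvexOn ℝ X f) {η : ℝ}
    (hη : 0 < η) {x z v : E} (hfz : DifferentiableAt ℝ f z)
    (hmin : IsMinOn (fun y => f y + 1 / (2 * η) * ‖y - x‖ ^ 2) X z) (hz : z ∈ X) (hv : v ∈ X) :
    η * f z + ‖z - x‖ ^ 2 / 2 + ‖v - z‖ ^ 2 / 2 ≤ η * f v + ‖v - x‖ ^ 2 / 2 := by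
  have hvar := hmin.inner_gradient_prox_le hf.1 hη hfz hz hv
  have htangent := mul_le_mul_of_nonneg_left (hf.add_inner_gradient_le hfz hz hv) hη.le
  have hneg : ⟪∇ f z, z - v⟫ = -⟪∇ f z, v - z⟫ := by
    rw [← inner_neg_right, neg_sub]
  rw [hneg] at hvar
  linarith

end ConvexDifferentiable

/-- The error terms of one inexact optimistic step are absorbed by the negative quadratic terms,
up to the summable quantity `D ^ 2 / τ ^ 2`. -/
theorem inexact_step_error_le {s q w r m A B K D τ C e : ℝ} (hm : 0 ≤ m) (hA : 0 ≤ A) (hB : 0 ≤ B) (hτ : 2 ≤ τ)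
    (hC : 15 + 8 * K ^ 2 ≤ C) (he : 0 ≤ e) (heC : e * (8 * τ ^ 2 * C) ≤ 1)
    (hsA : s ^ 2 ≤ 2 * e * A ^ 2) (hrB : r ^ 2 ≤ 2 * e * B ^ 2) (hms : m ≤ q + s)
    (hAw : A ≤ w + s) (hBA : B ≤ A + q + r) :
    m ^ 2 / 4 + K * s * m + D * r + e * (A ^ 2 + B ^ 2)
      ≤ q ^ 2 / 2 + w ^ 2 / 2 + D ^ 2 / τ ^ 2 := by
  have hτsq : 4 ≤ τ ^ 2 := by nlinarith
  have heτ : 0 ≤ e * τ ^ 2 := by positivity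
  have heτC : e * τ ^ 2 * (15 + 8 * K ^ 2) ≤ 1 / 8 := by
    have := mul_le_mul_of_nonneg_left hC heτ
    linarith
  have heτK : 0 ≤ e * τ ^ 2 * K ^ 2 := by positivity
  have heτ_le : e * τ ^ 2 ≤ 1 / 120 := by linarith
  have he_le : e ≤ 1 / 480 := by
    have := mul_le_mul_of_nonneg_left hτsq he
    linarith
  have heK : e * K ^ 2 ≤ 1 / 256 := by
    have := mul_le_mul_of_nonneg_left hτsq (mul_nonneg he (sq_nonneg K))
    linarith
  have hsA' : s ^ 2 ≤ A ^ 2 / 240 := by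
    have := mul_le_mul_of_nonneg_right he_le (sq_nonneg A)
    linarith
  have hrB' : r ^ 2 ≤ B ^ 2 / 240 := by
    have := mul_le_mul_of_nonneg_right he_le (sq_nonneg B)
    linarith
  have hKs : (K * s) ^ 2 ≤ A ^ 2 / 128 := by
    have h1 := mul_le_mul_of_nonneg_left hsA (sq_nonneg K)
    have h2 := mul_le_mul_of_nonneg_right heK (sq_nonneg A)
    linarith
  have hτr : (τ * r) ^ 2 ≤ B ^ 2 / 60 := by
    have h1 := mul_le_mul_of_nonneg_left hrB (sq_nonneg τ)
    have h2 := mul_le_mul_of_nonneg_right heτ_le (sq_nonneg B)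
    linarith
  have hm_sq : m ^ 2 ≤ 6 / 5 * q ^ 2 + 6 * s ^ 2 := by
    have := pow_le_pow_left₀ hm hms 2
    linarith [sq_nonneg (q - 5 * s)]
  have hA_sq : A ^ 2 ≤ 2 * w ^ 2 + 2 * s ^ 2 := by
    have := pow_le_pow_left₀ hA hAw 2
    linarith [sq_nonneg (w - s)]
  have hB_sq : B ^ 2 ≤ 3 * A ^ 2 + 3 * q ^ 2 + 3 * r ^ 2 := by
    have := pow_le_pow_left₀ hB hBA 2
    linarith [sq_nonneg (A - q), sq_nonneg (A - r), sq_nonneg (q - r)]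
  have hKsm : K * s * m ≤ m ^ 2 / 16 + 4 * (K * s) ^ 2 := by
    linarith [sq_nonneg (m / 4 - 2 * (K * s))]
  have hDr : D * r ≤ D ^ 2 / τ ^ 2 + (τ * r) ^ 2 / 4 := by
    have hsplit : D * r = D / τ * (τ * r) := by field_simp
    rw [hsplit, ← div_pow]
    linarith [sq_nonneg (D / τ - τ * r / 2)]
  have heAB : e * (A ^ 2 + B ^ 2) ≤ (A ^ 2 + B ^ 2) / 480 := by
    have := mul_le_mul_of_nonneg_right he_le (add_nonneg (sq_nonneg A) (sq_nonneg B))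
    linarith
  linarith [sq_nonneg A, sq_nonneg B, sq_nonneg q, sq_nonneg w]

theorem sum_Icc_inv_succ_sq_le (T : ℕ) :
    ∑ t ∈ Finset.Icc 1 T, 1 / ((t : ℝ) + 1) ^ 2 ≤ 1 - 1 / ((T : ℝ) + 1) := by
  induction T with
  | zero => simp
  | succ n ih =>
    rw [Finset.sum_Icc_succ_top (by omega)]
    have hstep : 1 / ((n : ℝ) + 1 + 1) ^ 2 ≤ 1 / ((n : ℝ) + 1) - 1 / ((n : ℝ) + 1 + 1) := by
      rw [div_sub_div _ _ (by positivity) (by positivity),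
        div_le_div_iff₀ (by positivity) (by positivity)]
      nlinarith [(Nat.cast_nonneg n : (0 : ℝ) ≤ n)]
    push_cast
    linarith

/-- Regret of a single inexact optimistic implicit step from `x`, with inexact hint step `y`,
inexact loss step `p`, and exact minimizers `ys`, `ps`. -/
theorem riod_step_regret {E : Type*} [NormedAddCommGroup E] [InnerProductSpace ℝ E]
    [CompleteSpace E] {X : Set E} {f h : E → ℝ} (hf : ConvexOn ℝ X f) (hh : ConvexOn ℝ X h)
    (hfd : Differentiable ℝ f) (hhd : Differentiable ℝ h)
    {D η L ε τ C : ℝ} (hdist : ∀ a ∈ X, ∀ b ∈ X, ‖a - b‖ ≤ D) (hη : 0 < η)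
    (hτ : 2 ≤ τ) (hC : 15 + 8 * (η * L) ^ 2 ≤ C) (hε : 0 ≤ ε)
    (hεC : η * ε * (8 * τ ^ 2 * C) ≤ 1) {x y ys p ps u : E} (hy : y ∈ X) (hys : ys ∈ X)
    (hp : p ∈ X) (hps : ps ∈ X) (hu : u ∈ X)
    (hsmooth : ‖∇ h y - ∇ h ys‖ ≤ L * ‖y - ys‖)
    (hysmin : IsMinOn (fun z => h z + 1 / (2 * η) * ‖z - x‖ ^ 2) X ys)
    (hpsmin : IsMinOn (fun z => f z + 1 / (2 * η) * ‖z - x‖ ^ 2) X ps)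
    (hyerr : (h y + 1 / (2 * η) * ‖y - x‖ ^ 2) - (h ys + 1 / (2 * η) * ‖ys - x‖ ^ 2)
      ≤ ε * ‖x - ys‖ ^ 2)
    (hperr : (f p + 1 / (2 * η) * ‖p - x‖ ^ 2) - (f ps + 1 / (2 * η) * ‖ps - x‖ ^ 2)
      ≤ ε * ‖x - ps‖ ^ 2) :
    η * (f y - f u) ≤ (‖u - x‖ ^ 2 - ‖u - p‖ ^ 2) / 2 + D ^ 2 * (1 / τ ^ 2)
      + η ^ 2 * ‖∇ f y - ∇ h y‖ ^ 2 := by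
  have hscale : ∀ {a b c d g : ℝ},
      (a + 1 / (2 * η) * b) - (c + 1 / (2 * η) * d) ≤ ε * g →
        η * a + b / 2 - (η * c + d / 2) ≤ η * ε * g := by
    intro a b c d g hle
    have hmul := mul_le_mul_of_nonneg_left hle hη.le
    have hcancel : η * ((a + 1 / (2 * η) * b) - (c + 1 / (2 * η) * d))
        = η * a + b / 2 - (η * c + d / 2) := by
      field_simp
    linarith
  have hyerr' := hscale hyerr
  have hperr' := hscale hperr
  have hygrowth := hh.prox_quadratic_growth hη (hhd ys) hysmin hys hy
  have hpgrowth := hf.prox_quadratic_growth hη (hfd ps) hpsmin hps hp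
  have hugrowth := hf.prox_quadratic_growth hη (hfd ps) hpsmin hps hu
  have herror := inexact_step_error_le (s := ‖y - ys‖) (q := ‖p - ys‖) (w := ‖y - x‖)
    (r := ‖p - ps‖) (m := ‖y - p‖) (A := ‖x - ys‖) (B := ‖x - ps‖) (K := η * L) (D := D)
    (norm_nonneg _) (norm_nonneg _) (norm_nonneg _) hτ hC (mul_nonneg hη.le hε) hεC (by linarith) (by linarith)
    (by
      rw [norm_sub_rev p ys, add_comm]
      exact norm_sub_le_norm_sub_add_norm_sub y ys p)
    (by
      rw [norm_sub_rev y x]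
      exact norm_sub_le_norm_sub_add_norm_sub x y ys)
    (by
      rw [norm_sub_rev p ys]
      exact (norm_sub_le_norm_sub_add_norm_sub x p ps).trans
        (add_le_add_left (norm_sub_le_norm_sub_add_norm_sub x ys p) _))
  have hvar := hysmin.inner_gradient_prox_le hh.1 hη (hhd ys) hys hp
  have htangent_f := mul_le_mul_of_nonneg_left (hf.add_inner_gradient_le (hfd y) hy hp) hη.le
  have htangent_h := mul_le_mul_of_nonneg_left (hh.add_inner_gradient_le (hhd ys) hys hy) hη.le
  have hsplit : ⟪∇ f y, p - y⟫ = -⟪∇ f y - ∇ h y, y - p⟫ - ⟪∇ h y - ∇ h ys, y - p⟫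
      - ⟪∇ h ys, y - ys⟫ - ⟪∇ h ys, ys - p⟫ := by
    simp only [inner_sub_left, inner_sub_right]
    ring
  have hhint : η * ⟪∇ f y - ∇ h y, y - p⟫
      ≤ η ^ 2 * ‖∇ f y - ∇ h y‖ ^ 2 + ‖y - p‖ ^ 2 / 4 := by
    have := mul_le_mul_of_nonneg_left (real_inner_le_norm (∇ f y - ∇ h y) (y - p)) hη.le
    linarith [sq_nonneg (η * ‖∇ f y - ∇ h y‖ - ‖y - p‖ / 2)]
  have hlip : η * ⟪∇ h y - ∇ h ys, y - p⟫ ≤ η * L * ‖y - ys‖ * ‖y - p‖ := by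
    have h1 := (real_inner_le_norm (∇ h y - ∇ h ys) (y - p)).trans
      (mul_le_mul_of_nonneg_right hsmooth (norm_nonneg _))
    have h2 := mul_le_mul_of_nonneg_left h1 hη.le
    linarith
  have hdrift : (‖u - p‖ ^ 2 - ‖u - ps‖ ^ 2) / 2 ≤ D * ‖p - ps‖ := by
    have htri := norm_sub_le_norm_sub_add_norm_sub u ps p
    rw [norm_sub_rev ps p] at htri
    have h1 := mul_le_mul_of_nonneg_right (hdist u hu p hp) (norm_nonneg (p - ps))
    have h2 := mul_le_mul_of_nonneg_right (hdist u hu ps hps) (norm_nonneg (p - ps))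
    have h3 := mul_le_mul_of_nonneg_right htri
      (add_nonneg (norm_nonneg (u - p)) (norm_nonneg (u - ps)))
    linarith
  rw [norm_sub_rev x ys] at *
  rw [norm_sub_rev x ps] at *
  rw [hsplit] at htangent_f
  rw [mul_one_div]
  linarith


/-- **RIOD (static regret), Euclidean case.** Theorem 2.1 of
"Implicit Riemannian Optimism with Applications to Min-Max Problems". -/
theorem riod_static_regret
    {E : Type*} [NormedAddCommGroup E] [InnerProductSpace ℝ E] [FiniteDimensional ℝ E]
    (X : Set E) (hXcomp : IsCompact X) (hXconv : Convex ℝ X)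
    (D : ℝ) (hD : 0 < D) (hXdiam : Metric.diam X ≤ D)
    (η : ℝ) (hη : 0 < η) (L : ℝ) (hL : 0 ≤ L) (M : ℝ) (hM : 0 ≤ M)
    (T : ℕ) (hT : 0 < T)
    (ℓ ℓh : ℕ → E → ℝ)
    (hdiff : ∀ t ∈ Finset.Icc 1 T, Differentiable ℝ (ℓ t) ∧ Differentiable ℝ (ℓh t))
    (hconv : ∀ t ∈ Finset.Icc 1 T, ConvexOn ℝ X (ℓ t) ∧ ConvexOn ℝ X (ℓh t))
    (hsmooth : ∀ t ∈ Finset.Icc 1 T, ∀ x ∈ X, ∀ y ∈ X,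
      ‖gradient (ℓ t) x - gradient (ℓ t) y‖ ≤ L * ‖x - y‖ ∧
      ‖gradient (ℓh t) x - gradient (ℓh t) y‖ ≤ L * ‖x - y‖)
    (hgradbdd : ∀ t ∈ Finset.Icc 1 T, ∀ x ∈ X,
      ‖gradient (ℓ t) x‖ ≤ M ∧ ‖gradient (ℓh t) x‖ ≤ M)
    (ε : ℕ → ℝ)
    (hε : ∀ t ∈ Finset.Icc 1 T, 0 < ε t ∧
      ε t ≤ 1 / (8 * η) *
        (((t : ℝ) + 1) ^ 2 * (15 + 8 * η ^ 2 * L ^ 2 + 2 * η ^ 2 * M ^ 2 / D ^ 2))⁻¹)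
    (x xh xs xhs : ℕ → E)
    (hx1 : x 1 ∈ X)
    (hmem : ∀ t ∈ Finset.Icc 1 T, xh t ∈ X ∧ x (t + 1) ∈ X)
    (hxhs : ∀ t ∈ Finset.Icc 1 T, xhs t ∈ X ∧
      IsMinOn (fun z => ℓh t z + 1 / (2 * η) * ‖z - x t‖ ^ 2) X (xhs t))
    (hxs : ∀ t ∈ Finset.Icc 1 T, xs (t + 1) ∈ X ∧
      IsMinOn (fun z => ℓ t z + 1 / (2 * η) * ‖z - x t‖ ^ 2) X (xs (t + 1)))
    (hinexact1 : ∀ t ∈ Finset.Icc 1 T,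
      (ℓh t (xh t) + 1 / (2 * η) * ‖xh t - x t‖ ^ 2)
        - (ℓh t (xhs t) + 1 / (2 * η) * ‖xhs t - x t‖ ^ 2)
        ≤ ε t * ‖x t - xhs t‖ ^ 2)
    (hinexact2 : ∀ t ∈ Finset.Icc 1 T,
      (ℓ t (x (t + 1)) + 1 / (2 * η) * ‖x (t + 1) - x t‖ ^ 2)
        - (ℓ t (xs (t + 1)) + 1 / (2 * η) * ‖xs (t + 1) - x t‖ ^ 2)
        ≤ ε t * ‖x t - xs (t + 1)‖ ^ 2) :
    ∀ u ∈ X,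
      ∑ t ∈ Finset.Icc 1 T, (ℓ t (xh t) - ℓ t u)
        ≤ 3 * D ^ 2 / (2 * η)
          + η * ∑ t ∈ Finset.Icc 1 T,
              ‖gradient (ℓ t) (xh t) - gradient (ℓh t) (xh t)‖ ^ 2 := by
  intro u hu
  have hdist : ∀ a ∈ X, ∀ b ∈ X, ‖a - b‖ ≤ D := fun a ha b hb => by
    rw [← dist_eq_norm]
    exact (Metric.dist_le_diam_of_mem hXcomp.isBounded ha hb).trans hXdiam
  have hstep : ∀ t ∈ Finset.Icc 1 T, η * (ℓ t (xh t) - ℓ t u)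
      ≤ (‖u - x t‖ ^ 2 - ‖u - x (t + 1)‖ ^ 2) / 2 + D ^ 2 * (1 / ((t : ℝ) + 1) ^ 2)
        + η ^ 2 * ‖∇ (ℓ t) (xh t) - ∇ (ℓh t) (xh t)‖ ^ 2 := by
    intro t ht
    have htpos : (1 : ℝ) ≤ t := by exact_mod_cast (Finset.mem_Icc.mp ht).1
    have hM' : 0 ≤ 2 * η ^ 2 * M ^ 2 / D ^ 2 := by positivity
    refine riod_step_regret (L := L)
      (C := 15 + 8 * η ^ 2 * L ^ 2 + 2 * η ^ 2 * M ^ 2 / D ^ 2) (hconv t ht).1 (hconv t ht).2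
      (hdiff t ht).1 (hdiff t ht).2 hdist hη (by linarith) (by linarith) (hε t ht).1.le ?_
      (hmem t ht).1 (hxhs t ht).1 (hmem t ht).2 (hxs t ht).1 hu
      (hsmooth t ht _ (hmem t ht).1 _ (hxhs t ht).1).2 (hxhs t ht).2 (hxs t ht).2
      (hinexact1 t ht) (hinexact2 t ht)
    have hle := (hε t ht).2
    rw [one_div, ← mul_inv, ← one_div, le_div_iff₀ (by positivity)] at hle
    linarith
  have hsum := Finset.sum_le_sum hstep
  have htele : ∑ t ∈ Finset.Icc 1 T, (‖u - x t‖ ^ 2 - ‖u - x (t + 1)‖ ^ 2) / 2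
      = (‖u - x 1‖ ^ 2 - ‖u - x (T + 1)‖ ^ 2) / 2 := by
    have h := Finset.sum_Icc_sub hT (fun t => -‖u - x t‖ ^ 2)
    simp only [neg_sub_neg] at h
    rw [← Finset.sum_div, h]
  rw [Finset.sum_add_distrib, Finset.sum_add_distrib, ← Finset.mul_sum, ← Finset.mul_sum,
    ← Finset.mul_sum, htele] at hsum
  have hinit : ‖u - x 1‖ ^ 2 ≤ D ^ 2 :=
    pow_le_pow_left₀ (norm_nonneg _) (hdist u hu _ hx1) 2
  have hharm : D ^ 2 * ∑ t ∈ Finset.Icc 1 T, 1 / ((t : ℝ) + 1) ^ 2 ≤ D ^ 2 := by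
    refine mul_le_of_le_one_right (sq_nonneg D) ((sum_Icc_inv_succ_sq_le T).trans ?_)
    exact sub_le_self _ (by positivity)
  refine le_of_mul_le_mul_left ?_ hη
  have hcancel : η * (3 * D ^ 2 / (2 * η)) = 3 * D ^ 2 / 2 := by field_simp
  rw [mul_add, hcancel]
  linarith [sq_nonneg ‖u - x (T + 1)‖]
end

section
/- Let E₁, E₂ be finite-dimensional real inner product spaces, X ⊆ E₁ and Y ⊆ E₂ compact convex sets, μ ≥ 0, L ≥ 0, and let f : E₁ × E₂ → ℝ be differentiable such that f(·,y) is μ-strongly convex on X for every y ∈ Y, f(x,·) is μ-strongly concave on Y for every x ∈ X, and f is L-smooth on X × Y. Let (x*, y*) ∈ X × Y be a saddle point of f on X × Y. Fix η > 0, tolerances ε_t^x, ε_t^y ≥ 0 with ε̄_t := 2η·max{ε_t^x, ε_t^y} < 1/4, parameters E_x > 0, E_y > 0 and Δ_t ∈ (0,1). Let (x_t, y_t, x̃_t, ỹ_t, x_{t+1}, y_{t+1}) be one step of a RIODA trajectory on X × Y with step η and tolerances (ε_t^x, ε_t^y), with exact proximal points x̃*_t, ỹ*_t, x*_{t+1},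 y*_{t+1}. Define C_t^x := (ε̄_t/(1 − 4ε̄_t))·(9 + 8η²L² + (1/Δ_t)·(4 + 2η‖∇_x f(x̃_t, y_t)‖²/E_x)) and C_t^y := (ε̄_t/(1 − 4ε̄_t))·(9 + 8η²L² + (1/Δ_t)·(4 + 2η‖∇_y f(x_t, ỹ_t)‖²/E_y)). Then f(x̃_t, y*) − f(x*, ỹ_t) ≤ (1/(2η))·(‖y_t − y*‖² + ‖x_t − x*‖² + (Δ_t − 1 − μη/2)·(‖y_{t+1} − y*‖² + ‖x_{t+1} − x*‖²)) + (L + (C_t^x − 3/4)/(2η))·‖x̃*_t − x_{t+1}‖² + (L + (C_t^y − 3/4)/(2η))·‖ỹ*_t − y_{t+1}‖² + (L(1 + 2ε̄_t) + (C_t^y + 4ε̄_t − 1)/(2η))·‖ỹ*_t − y_t‖² + (L(1 + 2ε̄_t) + (C_t^x + 4ε̄_t − 1)/(2η))·‖x̃*_t − x_t‖² + (E_x + E_y)·Δ_t/2. -/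
open Set

/-- Quadratic growth of a strongly convex function away from a constrained minimizer. -/
theorem StrongConvexOn.add_norm_sq_le_of_isMinOn {E : Type*} [NormedAddCommGroup E]
    [NormedSpace ℝ E] {s : Set E} {m : ℝ} {f : E → ℝ} {p z : E}
    (hf : StrongConvexOn s m f) (hp : p ∈ s) (hmin : IsMinOn f s p) (hz : z ∈ s) :
    f p + m / 2 * ‖z - p‖ ^ 2 ≤ f z := by
  have hstep : ∀ t ∈ Ioo (0 : ℝ) 1, f p + (1 - t) * (m / 2 * ‖z - p‖ ^ 2) ≤ f z := by
    intro t ht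
    have hconv := hf.2 hz hp ht.1.le (sub_nonneg.2 ht.2.le) (by ring)
    have hle := isMinOn_iff.1 hmin _
      (hf.1 hz hp ht.1.le (sub_nonneg.2 ht.2.le) (by ring : t + (1 - t) = 1))
    simp only [smul_eq_mul] at hconv
    have hscaled : t * (f p + (1 - t) * (m / 2 * ‖z - p‖ ^ 2)) ≤ t * f z := by linarith
    exact le_of_mul_le_mul_left hscaled ht.1
  have hlim : Filter.Tendsto (fun t : ℝ => f p + (1 - t) * (m / 2 * ‖z - p‖ ^ 2))
      (nhdsWithin 0 (Ioi 0)) (nhds (f p + m / 2 * ‖z - p‖ ^ 2)) := by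
    have hcont : Continuous fun t : ℝ => f p + (1 - t) * (m / 2 * ‖z - p‖ ^ 2) := by fun_prop
    simpa using (hcont.tendsto 0).mono_left nhdsWithin_le_nhds
  exact le_of_tendsto hlim
    (Filter.eventually_of_mem (Ioo_mem_nhdsGT (zero_lt_one' ℝ)) hstep)

/-- Quadratic growth of a proximal objective. -/
theorem StrongConvexOn.prox_growth {E : Type*} [NormedAddCommGroup E]
    [InnerProductSpace ℝ E] {s : Set E} {m η : ℝ} {f : E → ℝ} {c p z : E}
    (hf : StrongConvexOn s m f) (hp : p ∈ s)
    (hmin : IsMinOn (fun w => f w + 1 / (2 * η) * ‖w - c‖ ^ 2) s p) (hz : z ∈ s) :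
    f p + 1 / (2 * η) * ‖p - c‖ ^ 2 + (m + 1 / η) / 2 * ‖z - p‖ ^ 2
      ≤ f z + 1 / (2 * η) * ‖z - c‖ ^ 2 := by
  have hprox : StrongConvexOn s (m + 1 / η) (fun w => f w + 1 / (2 * η) * ‖w - c‖ ^ 2) := by
    rw [strongConvexOn_iff_convex] at hf ⊢
    have hlin : ConvexOn ℝ s (fun w => (-(1 / η)) * inner ℝ c w + 1 / (2 * η) * ‖c‖ ^ 2) := by
      refine ⟨hf.1, fun x _ y _ a b _ _ hab => le_of_eq ?_⟩
      simp only [inner_add_right, inner_smul_right, smul_eq_mul]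
      linear_combination (-(1 / (2 * η) * ‖c‖ ^ 2)) * hab
    refine (hf.add hlin).congr fun w _ => ?_
    simp only [Pi.add_apply]
    rw [norm_sub_sq_real, real_inner_comm]
    ring
  exact hprox.add_norm_sq_le_of_isMinOn hp hmin hz

theorem ConvexOn.sub_le_norm_fderiv_mul {E : Type*} [NormedAddCommGroup E] [NormedSpace ℝ E]
    {s : Set E} {f : E → ℝ} {x q : E} (hf : ConvexOn ℝ s f) (hd : DifferentiableAt ℝ f x)
    (hx : x ∈ s) (hq : q ∈ s) : f x - f q ≤ ‖fderiv ℝ f x‖ * ‖x - q‖ := by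
  have hline := hf.comp_affineMap (AffineMap.lineMap (k := ℝ) q x)
  have hderiv : HasDerivAt (f ∘ AffineMap.lineMap (k := ℝ) q x) (fderiv ℝ f x (x - q)) 1 := by
    refine HasFDerivAt.comp_hasDerivAt (1 : ℝ) ?_ AffineMap.hasDerivAt_lineMap
    simpa using hd.hasFDerivAt
  have hslope := hline.slope_le_of_hasDerivAt (x := 0) (y := 1)
    (by simpa using hq) (by simpa using hx) zero_lt_one hderiv
  have hval : f x - f q ≤ fderiv ℝ f x (x - q) := by simpa [slope_def_field] using hslope
  exact hval.trans ((le_abs_self _).trans ((fderiv ℝ f x).le_opNorm _))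

theorem norm_fderiv_eq_norm_gradient {E : Type*} [NormedAddCommGroup E] [InnerProductSpace ℝ E]
    [CompleteSpace E] (f : E → ℝ) (x : E) : ‖fderiv ℝ f x‖ = ‖gradient f x‖ := by
  simp [gradient]

/-- If the gradients of `f` and `g` are `K`-close, then `f - g` is `K`-Lipschitz. -/
theorem Convex.abs_sub_sub_le_of_norm_gradient_sub_le {E : Type*} [NormedAddCommGroup E]
    [InnerProductSpace ℝ E] [CompleteSpace E] {s : Set E} {f g : E → ℝ} {K : ℝ} {x y : E}
    (hs : Convex ℝ s) (hf : Differentiable ℝ f) (hg : Differentiable ℝ g)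
    (hK : ∀ z ∈ s, ‖gradient f z - gradient g z‖ ≤ K) (hx : x ∈ s) (hy : y ∈ s) :
    |(f x - g x) - (f y - g y)| ≤ K * ‖x - y‖ := by
  refine hs.norm_image_sub_le_of_norm_hasFDerivWithin_le (f := fun z => f z - g z)
    (fun z _ => ((hf z).hasFDerivAt.sub (hg z).hasFDerivAt).hasFDerivWithinAt) (fun z hz => ?_) hy hx
  have h := hK z hz
  rwa [gradient, gradient, ← map_sub, LinearIsometryEquiv.norm_map] at h

theorem norm_sq_le_two_mul_add {E : Type*} [SeminormedAddCommGroup E] (a b c : E) :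
    ‖a - c‖ ^ 2 ≤ 2 * ‖a - b‖ ^ 2 + 2 * ‖b - c‖ ^ 2 := by
  have h := norm_sub_le_norm_sub_add_norm_sub a b c
  nlinarith [sq_nonneg (‖a - b‖ - ‖b - c‖), norm_nonneg (a - c)]

theorem one_sub_mul_norm_sq_le {E : Type*} [SeminormedAddCommGroup E] (a b c : E) {δ : ℝ}
    (hδ : 0 < δ) (hδ1 : δ < 1) :
    (1 - δ) * ‖a - c‖ ^ 2 ≤ ‖b - c‖ ^ 2 + (1 / δ - 1) * ‖a - b‖ ^ 2 := by
  have h := norm_sub_le_norm_sub_add_norm_sub a b c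
  have hsq : ‖a - c‖ ^ 2 ≤ (‖a - b‖ + ‖b - c‖) ^ 2 := by gcongr
  have hmul := mul_le_mul_of_nonneg_left hsq (sub_nonneg.2 hδ1.le)
  have hid : ‖b - c‖ ^ 2 + (1 / δ - 1) * ‖a - b‖ ^ 2 - (1 - δ) * (‖a - b‖ + ‖b - c‖) ^ 2
      = ((1 - δ) * ‖a - b‖ - δ * ‖b - c‖) ^ 2 / δ := by
    field_simp
    ring
  have := div_nonneg (sq_nonneg ((1 - δ) * ‖a - b‖ - δ * ‖b - c‖)) hδ.le
  linarith

/-- An inexact proximal point is close to the exact one. -/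
theorem StrongConvexOn.inexact_prox_dist {E : Type*} [NormedAddCommGroup E]
    [InnerProductSpace ℝ E] {s : Set E} {m η ε e : ℝ} {f : E → ℝ} {c p z : E}
    (hf : StrongConvexOn s m f) (hη : 0 < η) (he : 2 * η * ε ≤ e) (hp : p ∈ s)
    (hmin : IsMinOn (fun w => f w + 1 / (2 * η) * ‖w - c‖ ^ 2) s p) (hz : z ∈ s)
    (hin : f z + 1 / (2 * η) * ‖z - c‖ ^ 2
      ≤ f p + 1 / (2 * η) * ‖p - c‖ ^ 2 + ε * ‖c - p‖ ^ 2) :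
    (1 + m * η) * ‖z - p‖ ^ 2 ≤ e * ‖c - p‖ ^ 2 := by
  have hgrowth := hf.prox_growth hp hmin hz
  have hle : (m + 1 / η) / 2 * ‖z - p‖ ^ 2 ≤ ε * ‖c - p‖ ^ 2 := by linarith
  have hmul := mul_le_mul_of_nonneg_left hle (by positivity : 0 ≤ 2 * η)
  have hid : 2 * η * ((m + 1 / η) / 2 * ‖z - p‖ ^ 2) = (1 + m * η) * ‖z - p‖ ^ 2 := by
    field_simp
    ring
  have hlast := mul_le_mul_of_nonneg_right he (sq_nonneg ‖c - p‖)
  linarith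

theorem StrongConvexOn.norm_sub_sq_le_of_inexact_prox {E : Type*} [NormedAddCommGroup E]
    [InnerProductSpace ℝ E] {s : Set E} {m η ε e : ℝ} {f : E → ℝ} {c p z : E}
    (hf : StrongConvexOn s m f) (hm : 0 ≤ m) (hη : 0 < η) (he : 2 * η * ε ≤ e) (hp : p ∈ s)
    (hmin : IsMinOn (fun w => f w + 1 / (2 * η) * ‖w - c‖ ^ 2) s p) (hz : z ∈ s)
    (hin : f z + 1 / (2 * η) * ‖z - c‖ ^ 2
      ≤ f p + 1 / (2 * η) * ‖p - c‖ ^ 2 + ε * ‖c - p‖ ^ 2) :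
    ‖z - p‖ ^ 2 ≤ e * ‖p - c‖ ^ 2 := by
  have h := hf.inexact_prox_dist hη he hp hmin hz hin
  have hnonneg : 0 ≤ m * η * ‖z - p‖ ^ 2 := by positivity
  rw [norm_sub_rev c p] at h
  linarith

/-- Regret of an inexact implicit update `n` on the loss `G`, compared with `u`. -/
theorem StrongConvexOn.inexact_prox_regret {E : Type*} [NormedAddCommGroup E]
    [InnerProductSpace ℝ E] {s : Set E} {m η ε e δ : ℝ} {G : E → ℝ} {c p n u : E}
    (hG : StrongConvexOn s m G) (hm : 0 ≤ m) (hη : 0 < η) (he : 2 * η * ε ≤ e)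
    (hδ : 0 < δ) (hδ1 : δ < 1) (hp : p ∈ s)
    (hmin : IsMinOn (fun w => G w + 1 / (2 * η) * ‖w - c‖ ^ 2) s p) (hn : n ∈ s) (hu : u ∈ s)
    (hin : G n + 1 / (2 * η) * ‖n - c‖ ^ 2
      ≤ G p + 1 / (2 * η) * ‖p - c‖ ^ 2 + ε * ‖c - p‖ ^ 2) :
    2 * η * (G n - G u) ≤ ‖c - u‖ ^ 2 + (δ - 1 - m * η / 2) * ‖n - u‖ ^ 2 - ‖n - c‖ ^ 2
      + (1 + 1 / δ) * (e * ‖c - p‖ ^ 2) := by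
  have hdist := hG.inexact_prox_dist hη he hp hmin hn hin
  have hgrowth := hG.prox_growth hp hmin hu
  have hle : G n - G u ≤ 1 / (2 * η) * ‖u - c‖ ^ 2 - 1 / (2 * η) * ‖n - c‖ ^ 2
      - (m + 1 / η) / 2 * ‖u - p‖ ^ 2 + ε * ‖c - p‖ ^ 2 := by linarith
  have hmul := mul_le_mul_of_nonneg_left hle (by positivity : 0 ≤ 2 * η)
  have hid : 2 * η * (1 / (2 * η) * ‖u - c‖ ^ 2 - 1 / (2 * η) * ‖n - c‖ ^ 2
      - (m + 1 / η) / 2 * ‖u - p‖ ^ 2 + ε * ‖c - p‖ ^ 2)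
      = ‖u - c‖ ^ 2 - ‖n - c‖ ^ 2 - (1 + m * η) * ‖u - p‖ ^ 2
        + 2 * η * ε * ‖c - p‖ ^ 2 := by
    field_simp
    ring
  rw [hid, norm_sub_rev u c, norm_sub_rev u p] at hmul
  have heps := mul_le_mul_of_nonneg_right he (sq_nonneg ‖c - p‖)
  have hyoung := one_sub_mul_norm_sq_le n p u hδ hδ1
  have hhalf := mul_le_mul_of_nonneg_left (norm_sq_le_two_mul_add n p u)
    (by positivity : 0 ≤ m * η / 2)
  have hδinv : 1 ≤ 1 / δ := by rw [le_div_iff₀ hδ]; linarith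
  have hscale := mul_le_mul_of_nonneg_left hdist (by positivity : 0 ≤ 1 / δ)
  have hcoef : (m * η + (1 / δ - 1)) * ‖n - p‖ ^ 2 ≤ 1 / δ * ((1 + m * η) * ‖n - p‖ ^ 2) := by
    rw [← mul_assoc]
    refine mul_le_mul_of_nonneg_right ?_ (sq_nonneg _)
    nlinarith [mul_nonneg hm hη.le]
  linarith

/-- One player's share of the online-to-minmax reduction: the optimistic point `z` is an inexact
proximal point of `F` and the update `n` an inexact proximal point of `G`, both from `c`. -/
theorem StrongConvexOn.inexact_optimistic_step {E : Type*} [NormedAddCommGroup E]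
    [InnerProductSpace ℝ E] {s : Set E} {m η ε e δ A L C : ℝ} {F G : E → ℝ} {c q z p n u : E}
    (hF : StrongConvexOn s m F) (hG : StrongConvexOn s m G) (hFd : DifferentiableAt ℝ F z)
    (hm : 0 ≤ m) (hη : 0 < η) (hε : 0 ≤ ε) (he : 2 * η * ε ≤ e) (he4 : e < 1 / 4)
    (hδ : 0 < δ) (hδ1 : δ < 1) (hA : 0 < A)
    (hC : C = e / (1 - 4 * e) *
      (9 + 8 * η ^ 2 * L ^ 2 + 1 / δ * (4 + 2 * η * ‖fderiv ℝ F z‖ ^ 2 / A)))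
    (hq : q ∈ s) (hqmin : IsMinOn (fun w => F w + 1 / (2 * η) * ‖w - c‖ ^ 2) s q)
    (hp : p ∈ s) (hpmin : IsMinOn (fun w => G w + 1 / (2 * η) * ‖w - c‖ ^ 2) s p)
    (hz : z ∈ s) (hn : n ∈ s) (hu : u ∈ s)
    (hinz : F z + 1 / (2 * η) * ‖z - c‖ ^ 2
      ≤ F q + 1 / (2 * η) * ‖q - c‖ ^ 2 + ε * ‖c - q‖ ^ 2)
    (hinn : G n + 1 / (2 * η) * ‖n - c‖ ^ 2
      ≤ G p + 1 / (2 * η) * ‖p - c‖ ^ 2 + ε * ‖c - p‖ ^ 2) :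
    F z - F n + (G n - G u) ≤
      1 / (2 * η) * (‖c - u‖ ^ 2 + (δ - 1 - m * η / 2) * ‖n - u‖ ^ 2)
        + (C - 3 / 4) / (2 * η) * ‖q - n‖ ^ 2 + (C + 4 * e - 1) / (2 * η) * ‖q - c‖ ^ 2
        + A * δ / 2 := by
  have he0 : 0 ≤ e := le_trans (by positivity) he
  have hmη : 0 ≤ m * η := mul_nonneg hm hη.le
  have hd : 0 < 1 - 4 * e := by linarith
  have hclose := hF.norm_sub_sq_le_of_inexact_prox hm hη he hq hqmin hz hinz
  have hndist := hG.norm_sub_sq_le_of_inexact_prox hm hη he hp hpmin hn hinn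
  have hregret := hG.inexact_prox_regret hm hη he hδ hδ1 hp hpmin hn hu hinn
  have hgrowth := hF.prox_growth hq hqmin hn
  have hgrowth' : 2 * η * (F q - F n) ≤ ‖n - c‖ ^ 2 - ‖q - c‖ ^ 2 - ‖q - n‖ ^ 2 := by
    have hle : F q - F n ≤ 1 / (2 * η) * ‖n - c‖ ^ 2 - 1 / (2 * η) * ‖q - c‖ ^ 2
      - (m + 1 / η) / 2 * ‖n - q‖ ^ 2 := by linarith
    have hmul := mul_le_mul_of_nonneg_left hle (by positivity : 0 ≤ 2 * η)
    have hid : 2 * η * (1 / (2 * η) * ‖n - c‖ ^ 2 - 1 / (2 * η) * ‖q - c‖ ^ 2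
        - (m + 1 / η) / 2 * ‖n - q‖ ^ 2)
        = ‖n - c‖ ^ 2 - ‖q - c‖ ^ 2 - (1 + m * η) * ‖n - q‖ ^ 2 := by
      field_simp
      ring
    have hnonneg := mul_nonneg hmη (sq_nonneg ‖n - q‖)
    rw [norm_sub_rev q n]
    linarith
  have hfirst := (hF.convexOn fun r => by positivity).sub_le_norm_fderiv_mul hFd hz hq
  set g := ‖fderiv ℝ F z‖
  have hgrad : 2 * η * (F z - F q)
      ≤ η * g ^ 2 / A * (1 / δ) * (e * ‖q - c‖ ^ 2) + 2 * η * (A * δ / 2) := by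
    have hyoung : g * ‖z - q‖ ≤ g ^ 2 * ‖z - q‖ ^ 2 / (2 * (A * δ)) + A * δ / 2 := by
      have hid : g ^ 2 * ‖z - q‖ ^ 2 / (2 * (A * δ)) + A * δ / 2 - g * ‖z - q‖
          = (g * ‖z - q‖ - A * δ) ^ 2 / (2 * (A * δ)) := by
        field_simp
        ring
      have : 0 ≤ (g * ‖z - q‖ - A * δ) ^ 2 / (2 * (A * δ)) := by positivity
      linarith
    have hmul := mul_le_mul_of_nonneg_left (hfirst.trans hyoung) (by positivity : 0 ≤ 2 * η)
    have hcl := mul_le_mul_of_nonneg_left hclose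
      (by positivity : 0 ≤ η * g ^ 2 / A * (1 / δ))
    have hid : 2 * η * (g ^ 2 * ‖z - q‖ ^ 2 / (2 * (A * δ)) + A * δ / 2)
        = η * g ^ 2 / A * (1 / δ) * ‖z - q‖ ^ 2 + 2 * η * (A * δ / 2) := by
      field_simp
    linarith
  have hcp : ‖c - p‖ ^ 2 ≤ 4 / (1 - 4 * e) * (‖q - c‖ ^ 2 + ‖q - n‖ ^ 2) := by
    have h₁ := norm_sq_le_two_mul_add c n p
    have h₂ := norm_sq_le_two_mul_add c q n
    rw [norm_sub_rev c q] at h₂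
    rw [div_mul_eq_mul_div, le_div_iff₀ hd]
    rw [norm_sub_rev p c] at hndist
    have hnonneg := mul_nonneg he0 (sq_nonneg ‖c - p‖)
    linarith
  have hcp' := mul_le_mul_of_nonneg_left hcp
    (by positivity : 0 ≤ (1 + 1 / δ) * e)
  set k := e / (1 - 4 * e) with hk
  have hk0 : 0 ≤ k := div_nonneg he0 hd.le
  have hek : e ≤ k := by
    rw [hk, le_div_iff₀ hd]
    have := mul_nonneg he0 he0
    linarith
  have hcpid : (1 + 1 / δ) * e * (4 / (1 - 4 * e) * (‖q - c‖ ^ 2 + ‖q - n‖ ^ 2))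
      = k * (4 + 4 * (1 / δ)) * (‖q - c‖ ^ 2 + ‖q - n‖ ^ 2) := by
    rw [hk]
    ring
  have hB : 0 ≤ η * g ^ 2 / A * (1 / δ) := by positivity
  have hCexp : C = k * (9 + 8 * η ^ 2 * L ^ 2 + 4 * (1 / δ))
      + 2 * (k * (η * g ^ 2 / A * (1 / δ))) := by
    rw [hC]
    ring
  have hL : 0 ≤ k * (8 * η ^ 2 * L ^ 2) := by positivity
  have hkB := mul_nonneg hk0 hB
  have heB := mul_le_mul_of_nonneg_right hek hB
  have hCn : k * (4 + 4 * (1 / δ)) - 1 ≤ C - 3 / 4 := by linarith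
  have hCc : k * (4 + 4 * (1 / δ)) + e * (η * g ^ 2 / A * (1 / δ)) - 1 ≤ C + 4 * e - 1 := by
    linarith
  have hqn := mul_le_mul_of_nonneg_right hCn (sq_nonneg ‖q - n‖)
  have hqc := mul_le_mul_of_nonneg_right hCc (sq_nonneg ‖q - c‖)
  have hscaled : 2 * η * (F z - F n + (G n - G u)) ≤
      2 * η * (1 / (2 * η) * (‖c - u‖ ^ 2 + (δ - 1 - m * η / 2) * ‖n - u‖ ^ 2)
        + (C - 3 / 4) / (2 * η) * ‖q - n‖ ^ 2 + (C + 4 * e - 1) / (2 * η) * ‖q - c‖ ^ 2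
        + A * δ / 2) := by
    have hid : 2 * η * (1 / (2 * η) * (‖c - u‖ ^ 2 + (δ - 1 - m * η / 2) * ‖n - u‖ ^ 2)
        + (C - 3 / 4) / (2 * η) * ‖q - n‖ ^ 2 + (C + 4 * e - 1) / (2 * η) * ‖q - c‖ ^ 2
        + A * δ / 2) = ‖c - u‖ ^ 2 + (δ - 1 - m * η / 2) * ‖n - u‖ ^ 2
        + (C - 3 / 4) * ‖q - n‖ ^ 2 + (C + 4 * e - 1) * ‖q - c‖ ^ 2 + 2 * η * (A * δ / 2) := by
      field_simp
    rw [hid]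
    linarith
  exact le_of_mul_le_mul_left hscaled (by positivity)

/-- Splitting of the cross term produced by the coupling of the two players. -/
theorem coupling_le {E E' : Type*} [SeminormedAddCommGroup E] [SeminormedAddCommGroup E']
    {L e : ℝ} {z q n c : E} {z' q' c' : E'} (hL : 0 ≤ L)
    (hz : ‖z - q‖ ^ 2 ≤ e * ‖q - c‖ ^ 2) (hz' : ‖z' - q'‖ ^ 2 ≤ e * ‖q' - c'‖ ^ 2) :
    L * ‖z' - c'‖ * ‖z - n‖ ≤ L * ‖q - n‖ ^ 2 + L * e * ‖q - c‖ ^ 2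
      + L * (1 + e) * ‖q' - c'‖ ^ 2 := by
  have h₁ := norm_sq_le_two_mul_add z q n
  have h₂ := norm_sq_le_two_mul_add z' q' c'
  have h₃ := two_mul_le_add_sq ‖z' - c'‖ ‖z - n‖
  have hle : ‖z' - c'‖ * ‖z - n‖
      ≤ ‖q - n‖ ^ 2 + e * ‖q - c‖ ^ 2 + (1 + e) * ‖q' - c'‖ ^ 2 := by linarith
  have := mul_le_mul_of_nonneg_left hle hL
  linarith


/-- **Online-to-minmax reduction (one RIODA step), Euclidean case.** Lemma B.1 of
"Implicit Riemannian Optimism with Applications to Min-Max Problems". -/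
theorem rioda_online_to_minmax_reduction
    {E₁ E₂ : Type*}
    [NormedAddCommGroup E₁] [InnerProductSpace ℝ E₁] [FiniteDimensional ℝ E₁]
    [NormedAddCommGroup E₂] [InnerProductSpace ℝ E₂] [FiniteDimensional ℝ E₂]
    (X : Set E₁) (Y : Set E₂)
    (hXcomp : IsCompact X) (hXconv : Convex ℝ X)
    (hYcomp : IsCompact Y) (hYconv : Convex ℝ Y)
    (μ L : ℝ) (hμ : 0 ≤ μ) (hL : 0 ≤ L)
    (f : E₁ × E₂ → ℝ) (hdiff : Differentiable ℝ f)
    (hconv : ∀ y ∈ Y, ConvexOn ℝ X (fun x => f (x, y) - μ / 2 * ‖x‖ ^ 2))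
    (hconc : ∀ x ∈ X, ConvexOn ℝ Y (fun y => -f (x, y) - μ / 2 * ‖y‖ ^ 2))
    (hsmooth_xx : ∀ y ∈ Y, ∀ x ∈ X, ∀ x' ∈ X,
      ‖gradient (fun z => f (z, y)) x - gradient (fun z => f (z, y)) x'‖ ≤ L * ‖x - x'‖)
    (hsmooth_yy : ∀ x ∈ X, ∀ y ∈ Y, ∀ y' ∈ Y,
      ‖gradient (fun w => f (x, w)) y - gradient (fun w => f (x, w)) y'‖ ≤ L * ‖y - y'‖)
    (hsmooth_xy : ∀ x ∈ X, ∀ y ∈ Y, ∀ y' ∈ Y,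
      ‖gradient (fun z => f (z, y)) x - gradient (fun z => f (z, y')) x‖ ≤ L * ‖y - y'‖)
    (hsmooth_yx : ∀ y ∈ Y, ∀ x ∈ X, ∀ x' ∈ X,
      ‖gradient (fun w => f (x, w)) y - gradient (fun w => f (x', w)) y‖ ≤ L * ‖x - x'‖)
    (xstar : E₁) (ystar : E₂) (hxstar : xstar ∈ X) (hystar : ystar ∈ Y)
    (hsaddle : ∀ x ∈ X, ∀ y ∈ Y, f (xstar, y) ≤ f (xstar, ystar) ∧ f (xstar, ystar) ≤ f (x, ystar))
    (η : ℝ) (hη : 0 < η)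
    (εx εy : ℝ) (hεx : 0 ≤ εx) (hεy : 0 ≤ εy)
    (εb : ℝ) (hεb : εb = 2 * η * max εx εy) (hεb4 : εb < 1 / 4)
    (Ex Ey : ℝ) (hEx : 0 < Ex) (hEy : 0 < Ey)
    (Δ : ℝ) (hΔ : Δ ∈ Set.Ioo (0 : ℝ) 1)
    (xt xtil xnext xtilstar xnextstar : E₁) (yt ytil ynext ytilstar ynextstar : E₂)
    (hxt : xt ∈ X) (hyt : yt ∈ Y)
    (hxtil : xtil ∈ X) (hytil : ytil ∈ Y) (hxnext : xnext ∈ X) (hynext : ynext ∈ Y)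
    (hxtilstar : xtilstar ∈ X ∧
      IsMinOn (fun z => f (z, yt) + 1 / (2 * η) * ‖z - xt‖ ^ 2) X xtilstar)
    (hytilstar : ytilstar ∈ Y ∧
      IsMaxOn (fun w => f (xt, w) - 1 / (2 * η) * ‖w - yt‖ ^ 2) Y ytilstar)
    (hxnextstar : xnextstar ∈ X ∧
      IsMinOn (fun z => f (z, ytil) + 1 / (2 * η) * ‖z - xt‖ ^ 2) X xnextstar)
    (hynextstar : ynextstar ∈ Y ∧
      IsMaxOn (fun w => f (xtil, w) - 1 / (2 * η) * ‖w - yt‖ ^ 2) Y ynextstar)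
    (hin1 : f (xtil, yt) + 1 / (2 * η) * ‖xtil - xt‖ ^ 2
      ≤ f (xtilstar, yt) + 1 / (2 * η) * ‖xtilstar - xt‖ ^ 2 + εx * ‖xt - xtilstar‖ ^ 2)
    (hin2 : -f (xt, ytil) + 1 / (2 * η) * ‖ytil - yt‖ ^ 2
      ≤ -f (xt, ytilstar) + 1 / (2 * η) * ‖ytilstar - yt‖ ^ 2 + εy * ‖yt - ytilstar‖ ^ 2)
    (hin3 : f (xnext, ytil) + 1 / (2 * η) * ‖xnext - xt‖ ^ 2
      ≤ f (xnextstar, ytil) + 1 / (2 * η) * ‖xnextstar - xt‖ ^ 2 + εx * ‖xt - xnextstar‖ ^ 2)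
    (hin4 : -f (xtil, ynext) + 1 / (2 * η) * ‖ynext - yt‖ ^ 2
      ≤ -f (xtil, ynextstar) + 1 / (2 * η) * ‖ynextstar - yt‖ ^ 2 + εy * ‖yt - ynextstar‖ ^ 2)
    (Cx Cy : ℝ)
    (hCx : Cx = εb / (1 - 4 * εb) *
      (9 + 8 * η ^ 2 * L ^ 2
        + 1 / Δ * (4 + 2 * η * ‖gradient (fun z => f (z, yt)) xtil‖ ^ 2 / Ex)))
    (hCy : Cy = εb / (1 - 4 * εb) *
      (9 + 8 * η ^ 2 * L ^ 2
        + 1 / Δ * (4 + 2 * η * ‖gradient (fun w => f (xt, w)) ytil‖ ^ 2 / Ey))) :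
    f (xtil, ystar) - f (xstar, ytil)
      ≤ 1 / (2 * η) * (‖yt - ystar‖ ^ 2 + ‖xt - xstar‖ ^ 2
            + (Δ - 1 - μ * η / 2) * (‖ynext - ystar‖ ^ 2 + ‖xnext - xstar‖ ^ 2))
        + (L + (Cx - 3 / 4) / (2 * η)) * ‖xtilstar - xnext‖ ^ 2
        + (L + (Cy - 3 / 4) / (2 * η)) * ‖ytilstar - ynext‖ ^ 2
        + (L * (1 + 2 * εb) + (Cy + 4 * εb - 1) / (2 * η)) * ‖ytilstar - yt‖ ^ 2
        + (L * (1 + 2 * εb) + (Cx + 4 * εb - 1) / (2 * η)) * ‖xtilstar - xt‖ ^ 2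
        + (Ex + Ey) * Δ / 2 := by
  have hεx' : 2 * η * εx ≤ εb := by
    rw [hεb]
    gcongr
    exact le_max_left _ _
  have hεy' : 2 * η * εy ≤ εb := by
    rw [hεb]
    gcongr
    exact le_max_right _ _
  have hdx : ∀ y, Differentiable ℝ fun z => f (z, y) := fun y => by fun_prop
  have hdy : ∀ x, Differentiable ℝ fun w => f (x, w) := fun x => by fun_prop
  have hscx : ∀ y ∈ Y, StrongConvexOn X μ fun z => f (z, y) := fun y hy =>
    strongConvexOn_iff_convex.2 (hconv y hy)
  have hscy : ∀ x ∈ X, StrongConvexOn Y μ fun w => -f (x, w) := fun x hx =>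
    strongConvexOn_iff_convex.2 (hconc x hx)
  have hneg : ∀ x y, IsMaxOn (fun w => f (x, w) - 1 / (2 * η) * ‖w - yt‖ ^ 2) Y y →
      IsMinOn (fun w => -f (x, w) + 1 / (2 * η) * ‖w - yt‖ ^ 2) Y y := by
    intro x y h
    simpa [sub_eq_add_neg, add_comm] using h.neg
  have hytilmin := hneg _ _ hytilstar.2
  have hynextmin := hneg _ _ hynextstar.2
  have hnorm_neg : ‖fderiv ℝ (fun w => -f (xt, w)) ytil‖ = ‖gradient (fun w => f (xt, w)) ytil‖ := by
    rw [fderiv_fun_neg, norm_neg, norm_fderiv_eq_norm_gradient]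
  rw [← norm_fderiv_eq_norm_gradient] at hCx
  rw [← hnorm_neg] at hCy
  have hstepx := (hscx yt hyt).inexact_optimistic_step (hscx ytil hytil) (hdx yt xtil) hμ hη hεx
    hεx' hεb4 hΔ.1 hΔ.2 hEx hCx hxtilstar.1 hxtilstar.2 hxnextstar.1 hxnextstar.2 hxtil hxnext
    hxstar hin1 hin3
  have hstepy := (hscy xt hxt).inexact_optimistic_step (hscy xtil hxtil) (hdy xt ytil).neg hμ hη hεy
    hεy' hεb4 hΔ.1 hΔ.2 hEy hCy hytilstar.1 hytilmin hynextstar.1 hynextmin hytil hynext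
    hystar hin2 hin4
  have hdistx : ‖xtil - xtilstar‖ ^ 2 ≤ εb * ‖xtilstar - xt‖ ^ 2 :=
    (hscx yt hyt).norm_sub_sq_le_of_inexact_prox hμ hη hεx' hxtilstar.1 hxtilstar.2 hxtil hin1
  have hdisty : ‖ytil - ytilstar‖ ^ 2 ≤ εb * ‖ytilstar - yt‖ ^ 2 :=
    (hscy xt hxt).norm_sub_sq_le_of_inexact_prox hμ hη hεy' hytilstar.1 hytilmin hytil hin2
  have hmixx := (le_abs_self _).trans (hXconv.abs_sub_sub_le_of_norm_gradient_sub_le (hdx ytil)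
    (hdx yt) (fun x hx => hsmooth_xy x hx ytil hytil yt hyt) hxtil hxnext)
  have hmixy := (neg_le_abs _).trans (hYconv.abs_sub_sub_le_of_norm_gradient_sub_le (hdy xtil)
    (hdy xt) (fun y hy => hsmooth_yx y hy xtil hxtil xt hxt) hytil hynext)
  have hcx := coupling_le (n := xnext) hL hdistx hdisty
  have hcy := coupling_le (n := ynext) hL hdisty hdistx
  linarith
end

section
/- Let E₁, E₂ be finite-dimensional real inner product spaces, X ⊆ E₁ and Y ⊆ E₂ compact convex sets, L > 0, M ≥ 0, and let f : E₁ × E₂ → ℝ be differentiable, convex-concave on X × Y, L-smooth on X × Y, and satisfy ‖∇_x f(x,y)‖ ≤ M, ‖∇_y f(x,y)‖ ≤ M for all (x,y) ∈ X × Y. Let (x*, y*) ∈ X × Y be a saddle point of f on X × Y, set η := 1/(4L), fix (x_1, y_1) ∈ X × Y, let R := ‖x_1 − x*‖ + ‖y_1 − y*‖, and let ε > 0 and a positive integer T. Let (x_t, y_t, x̃_t, ỹ_t)_{t=1}^{T} be a RIODA trajectory on X × Y with step η and tolerances (ε_t^x, ε_t^y) satisfying, for every t ∈ {1,…,T}: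 ε̄_t := 2η·max{ε_t^x, ε_t^y} < 1/4 and (ε̄_t/(1 − 4ε̄_t))·(9 + 8η²L² + (t+1)²·(4 + 12ηM²/ε)) + 5ε̄_t ≤ 1/4. Then the averages x̄_T := (1/T)·∑_{t=1}^{T} x̃_t and ȳ_T := (1/T)·∑_{t=1}^{T} ỹ_t satisfy f(x̄_T, y*) − f(x*, ȳ_T) ≤ 4LR²/T + ε/2; in particular, f(x̄_T, y*) − f(x*, ȳ_T) ≤ ε whenever T ≥ 8LR²/ε. -/
/-- Three-point inequality for an exact proximal point of a convex function. -/
theorem prox_three_point {E : Type*} [NormedAddCommGroup E] [InnerProductSpace ℝ E]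
    {C : Set E} {φ : E → ℝ} (hφ : ConvexOn ℝ C φ) {a : ℝ} {p z u : E}
    (hz : z ∈ C) (hu : u ∈ C) (hmin : IsMinOn (fun w => φ w + a * ‖w - p‖ ^ 2) C z) :
    φ z + a * ‖z - p‖ ^ 2 + a * ‖z - u‖ ^ 2 ≤ φ u + a * ‖u - p‖ ^ 2 := by
  have key : ∀ s : ℝ, 0 < s → s ≤ 1 →
      φ z + a * ‖z - p‖ ^ 2 + a * (1 - s) * ‖z - u‖ ^ 2 ≤ φ u + a * ‖u - p‖ ^ 2 := by
    intro s hs hs1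
    have hmem : (1 - s) • z + s • u ∈ C := hφ.1 hz hu (by linarith) hs.le (by ring)
    have h1 : φ z + a * ‖z - p‖ ^ 2 ≤ φ ((1 - s) • z + s • u)
        + a * ‖(1 - s) • z + s • u - p‖ ^ 2 := hmin hmem
    have h2 : φ ((1 - s) • z + s • u) ≤ (1 - s) * φ z + s * φ u :=
      hφ.2 hz hu (by linarith) hs.le (by ring)
    have hquad : ∀ v w : E, ‖(1 - s) • v + s • w‖ ^ 2
        = (1 - s) * ‖v‖ ^ 2 + s * ‖w‖ ^ 2 - s * (1 - s) * ‖v - w‖ ^ 2 := by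
      intro v w
      rw [norm_add_sq_real, norm_sub_sq_real, norm_smul, norm_smul, inner_smul_left,
        inner_smul_right, mul_pow, mul_pow, Real.norm_eq_abs, Real.norm_eq_abs, sq_abs, sq_abs]
      simp only [conj_trivial]
      ring
    have h3 : ‖(1 - s) • z + s • u - p‖ ^ 2
        = (1 - s) * ‖z - p‖ ^ 2 + s * ‖u - p‖ ^ 2 - s * (1 - s) * ‖z - u‖ ^ 2 := by
      have e1 : (1 - s) • z + s • u - p = (1 - s) • (z - p) + s • (u - p) := by module
      rw [e1, hquad, sub_sub_sub_cancel_right]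
    rw [h3] at h1
    have : 0 ≤ s * (φ u + a * ‖u - p‖ ^ 2
        - (φ z + a * ‖z - p‖ ^ 2 + a * (1 - s) * ‖z - u‖ ^ 2)) := by nlinarith
    linarith [nonneg_of_mul_nonneg_right this hs]
  have hlim : Filter.Tendsto
      (fun s : ℝ => φ z + a * ‖z - p‖ ^ 2 + a * (1 - s) * ‖z - u‖ ^ 2)
      (nhdsWithin 0 (Set.Ioi 0)) (nhds (φ z + a * ‖z - p‖ ^ 2 + a * ‖z - u‖ ^ 2)) := by
    have hc : Continuous
        (fun s : ℝ => φ z + a * ‖z - p‖ ^ 2 + a * (1 - s) * ‖z - u‖ ^ 2) := by fun_prop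
    simpa using (hc.tendsto 0).mono_left nhdsWithin_le_nhds
  refine le_of_tendsto hlim ?_
  filter_upwards [Ioc_mem_nhdsGT (zero_lt_one (α := ℝ))] with s hs using key s hs.1 hs.2

/-- If the gradients of two functions stay `K`-close on a convex set, their difference is
`K`-Lipschitz there. -/
theorem sub_sub_sub_le_of_norm_gradient_sub_le {E : Type*} [NormedAddCommGroup E]
    [InnerProductSpace ℝ E] [CompleteSpace E] {C : Set E} (hC : Convex ℝ C) {g h : E → ℝ}
    (hg : Differentiable ℝ g) (hh : Differentiable ℝ h) {K : ℝ}
    (hK : ∀ x ∈ C, ‖gradient g x - gradient h x‖ ≤ K) {a b : E} (ha : a ∈ C) (hb : b ∈ C) :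
    (g a - h a) - (g b - h b) ≤ K * ‖a - b‖ := by
  have hbound : ∀ x ∈ C, ‖fderiv ℝ (fun z => g z - h z) x‖ ≤ K := by
    intro x hx
    rw [fderiv_fun_sub (hg x) (hh x)]
    have := hK x hx
    rwa [gradient, gradient, ← map_sub, LinearIsometryEquiv.norm_map] at this
  have := hC.norm_image_sub_le_of_norm_fderiv_le
    (fun x _ => (hg x).sub (hh x)) hbound hb ha
  exact (le_abs_self _).trans this

/-- The error budget of one inexact optimistic proximal step, in terms of the distances
between the points involved. -/
theorem optimistic_step_error_le {δ k N P A Q B V S W U D : ℝ}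
    (hδ : δ ≤ 1 / 100) (hk : 1 < k) (hkδ : k * δ ≤ 1 / 16) (hN : 0 ≤ N)
    (hV0 : 0 ≤ V) (hS0 : 0 ≤ S) (hU0 : 0 ≤ U)
    (hA : A ^ 2 ≤ δ * V ^ 2) (hB : B ^ 2 ≤ δ * S ^ 2)
    (tV : V ≤ P + A) (tS : S ≤ V + Q + B) (tX : D ≤ A + Q) (tU : U ≤ W + B) :
    (1 - 1 / k) * U ^ 2 + N * D / 2 + δ * V ^ 2 + δ * S ^ 2 + P ^ 2 / 2
      ≤ W ^ 2 + P ^ 2 + Q ^ 2 + N ^ 2 / 2 := by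
  have hA' : A ≤ V / 10 :=
    (abs_le_of_sq_le_sq' (by nlinarith [sq_nonneg V]) (by linarith)).2
  have hB' : B ≤ S / 10 :=
    (abs_le_of_sq_le_sq' (by nlinarith [sq_nonneg S]) (by linarith)).2
  have hV : V ≤ 10 / 9 * P := by linarith
  have hS : S ≤ 100 / 81 * P + 10 / 9 * Q := by linarith
  have hD : D ≤ P / 9 + Q := by linarith
  have hV2 : δ * V ^ 2 ≤ 1 / 80 * P ^ 2 := by
    have : V ^ 2 ≤ (10 / 9 * P) ^ 2 := pow_le_pow_left₀ hV0 hV 2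
    nlinarith [mul_le_mul_of_nonneg_right hδ (sq_nonneg V)]
  have hS2 : k * δ * S ^ 2 ≤ 20 / 100 * P ^ 2 + 16 / 100 * Q ^ 2 := by
    have : S ^ 2 ≤ (100 / 81 * P + 10 / 9 * Q) ^ 2 := pow_le_pow_left₀ hS0 hS 2
    nlinarith [mul_le_mul_of_nonneg_right hkδ (sq_nonneg S),
      sq_nonneg (100 / 81 * P - 10 / 9 * Q)]
  have hU : (1 - 1 / k) * U ^ 2 ≤ W ^ 2 + (k - 1) * B ^ 2 := by
    have h1 : (k - 1) * U ^ 2 ≤ k * (W ^ 2 + (k - 1) * B ^ 2) := by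
      have : U ^ 2 ≤ (W + B) ^ 2 := pow_le_pow_left₀ hU0 tU 2
      have := mul_le_mul_of_nonneg_left this (by linarith : 0 ≤ k - 1)
      linarith [sq_nonneg (W - (k - 1) * B)]
    have h2 : (1 - 1 / k) * U ^ 2 = (k - 1) * U ^ 2 / k := by
      have : k ≠ 0 := by linarith
      field_simp
    rw [h2, div_le_iff₀ (by linarith)]
    linarith
  have hB2 : (k - 1) * B ^ 2 ≤ (k - 1) * (δ * S ^ 2) :=
    mul_le_mul_of_nonneg_left hB (by linarith)
  have hcr : N * D ≤ P ^ 2 / 18 + Q ^ 2 / 2 + 10 / 18 * N ^ 2 := by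
    linarith [mul_le_mul_of_nonneg_left hD hN, sq_nonneg (N - P), sq_nonneg (N - Q)]
  linarith [sq_nonneg P, sq_nonneg Q, sq_nonneg N]

/-- One-block estimate for an optimistic inexact proximal step: `xt` is an inexact proximal point
of the prediction `φ`, `xn` one of the actual function `ψ`, both centred at `p`. -/
theorem inexact_optimistic_step {E : Type*} [NormedAddCommGroup E] [InnerProductSpace ℝ E]
    {C : Set E} {φ ψ : E → ℝ} (hφ : ConvexOn ℝ C φ) (hψ : ConvexOn ℝ C ψ)
    {L δ k e N : ℝ} (hL : 0 < L) (hδ : δ ≤ 1 / 100) (hk : 1 < k)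
    (hkδ : k * δ ≤ 1 / 16) (he : e ≤ 2 * L * δ) {p xt xts xn xns u : E}
    (hxt : xt ∈ C) (hxts : xts ∈ C) (hxn : xn ∈ C) (hxns : xns ∈ C) (hu : u ∈ C)
    (hmin : IsMinOn (fun z => φ z + 2 * L * ‖z - p‖ ^ 2) C xts)
    (hmin' : IsMinOn (fun z => ψ z + 2 * L * ‖z - p‖ ^ 2) C xns)
    (hin : φ xt + 2 * L * ‖xt - p‖ ^ 2 ≤ φ xts + 2 * L * ‖xts - p‖ ^ 2 + e * ‖p - xts‖ ^ 2)
    (hin' : ψ xn + 2 * L * ‖xn - p‖ ^ 2 ≤ ψ xns + 2 * L * ‖xns - p‖ ^ 2 + e * ‖p - xns‖ ^ 2)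
    (hN : 0 ≤ N)
    (hcross : (ψ xt - φ xt) - (ψ xn - φ xn) ≤ L * N * ‖xt - xn‖) :
    ψ xt - ψ u ≤ 2 * L * ‖p - u‖ ^ 2 - (1 - 1 / k) * (2 * L * ‖xn - u‖ ^ 2)
      - L * ‖xt - p‖ ^ 2 + L * N ^ 2 := by
  have a1 := prox_three_point hφ hxts hxt hmin
  have a2 := prox_three_point hφ hxts hxn hmin
  have a3 := prox_three_point hψ hxns hxn hmin'
  have a4 := prox_three_point hψ hxns hu hmin'
  rw [norm_sub_rev u p] at a4
  rw [norm_sub_rev xts xt] at a1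
  rw [norm_sub_rev xns xn] at a3
  have tV : ‖p - xts‖ ≤ ‖xt - p‖ + ‖xt - xts‖ := by
    rw [norm_sub_rev xt p]; exact norm_sub_le_norm_sub_add_norm_sub p xt xts
  have tS : ‖p - xns‖ ≤ ‖p - xts‖ + ‖xts - xn‖ + ‖xn - xns‖ :=
    (norm_sub_le_norm_sub_add_norm_sub p xn xns).trans
      (by linarith [norm_sub_le_norm_sub_add_norm_sub p xts xn])
  have tX : ‖xt - xn‖ ≤ ‖xt - xts‖ + ‖xts - xn‖ := norm_sub_le_norm_sub_add_norm_sub _ _ _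
  have tU : ‖xn - u‖ ≤ ‖xns - u‖ + ‖xn - xns‖ := by
    linarith [norm_sub_le_norm_sub_add_norm_sub xn xns u]
  have eV := mul_le_mul_of_nonneg_right he (sq_nonneg ‖p - xts‖)
  have eS := mul_le_mul_of_nonneg_right he (sq_nonneg ‖p - xns‖)
  have hA : ‖xt - xts‖ ^ 2 ≤ δ * ‖p - xts‖ ^ 2 :=
    le_of_mul_le_mul_left (by linarith) (by linarith : 0 < 2 * L)
  have hB : ‖xn - xns‖ ^ 2 ≤ δ * ‖p - xns‖ ^ 2 :=
    le_of_mul_le_mul_left (by linarith) (by linarith : 0 < 2 * L)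
  have hbudget := mul_le_mul_of_nonneg_left
    (optimistic_step_error_le hδ hk hkδ hN (norm_nonneg _) (norm_nonneg _)
      (norm_nonneg _) hA hB tV tS tX tU) (by linarith : 0 ≤ 2 * L)
  linarith

/-- Summing a recursion with contraction factors `1 - 1 / (t + 1) ^ 2`, whose product is at least
`1 / 2`. -/
theorem sum_le_two_mul_of_quasi_telescope {g Φ : ℕ → ℝ} {T : ℕ} (hΦ : ∀ t, 0 ≤ Φ t)
    (hg : ∀ t ∈ Finset.Icc 1 T, 0 ≤ g t)
    (h : ∀ t ∈ Finset.Icc 1 T, g t ≤ Φ t - (1 - 1 / ((t : ℝ) + 1) ^ 2) * Φ (t + 1)) :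
    ∑ t ∈ Finset.Icc 1 T, g t ≤ 2 * Φ 1 := by
  have key : ∀ n ≤ T, ∑ t ∈ Finset.Icc 1 n, g t
      ≤ 2 * Φ 1 - ((n : ℝ) + 2) / (n + 1) * Φ (n + 1) := by
    intro n
    induction n with
    | zero => intro _; simp
    | succ n ih =>
      intro hn
      have hm : n + 1 ∈ Finset.Icc 1 T := by simp [hn]
      have h1 := ih (by omega)
      have h2 := h _ hm
      have h3 := hg _ hm
      rw [Finset.sum_Icc_succ_top (by omega)]
      push_cast at h2 ⊢
      have hp : (0 : ℝ) < (n : ℝ) + 1 := by positivity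
      have hw : 1 ≤ ((n : ℝ) + 2) / (n + 1) := by rw [le_div_iff₀ hp]; linarith
      have h4 := mul_le_mul_of_nonneg_left h2 (by linarith : 0 ≤ ((n : ℝ) + 2) / (n + 1))
      have h5 : ((n : ℝ) + 2) / (n + 1) * (1 - 1 / ((n : ℝ) + 1 + 1) ^ 2)
          = ((n : ℝ) + 1 + 2) / (n + 1 + 1) := by
        field_simp
        ring
      rw [mul_sub, ← mul_assoc, h5] at h4
      nlinarith
  have := key T le_rfl
  have hp : 0 ≤ ((T : ℝ) + 2) / (T + 1) * Φ (T + 1) := mul_nonneg (by positivity) (hΦ _)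
  linarith

/-- **RIODA, convex-concave case (constrained), Euclidean instance.** Theorem 3.1 of
"Implicit Riemannian Optimism with Applications to Min-Max Problems". -/
theorem rioda_convex_concave
    {E₁ E₂ : Type*}
    [NormedAddCommGroup E₁] [InnerProductSpace ℝ E₁] [FiniteDimensional ℝ E₁]
    [NormedAddCommGroup E₂] [InnerProductSpace ℝ E₂] [FiniteDimensional ℝ E₂]
    (X : Set E₁) (Y : Set E₂)
    (hXcomp : IsCompact X) (hXconv : Convex ℝ X)
    (hYcomp : IsCompact Y) (hYconv : Convex ℝ Y)
    (L : ℝ) (hL : 0 < L) (M : ℝ) (hM : 0 ≤ M)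
    (f : E₁ × E₂ → ℝ) (hdiff : Differentiable ℝ f)
    (hconv : ∀ y ∈ Y, ConvexOn ℝ X (fun x => f (x, y)))
    (hconc : ∀ x ∈ X, ConcaveOn ℝ Y (fun y => f (x, y)))
    (hsmooth_xx : ∀ y ∈ Y, ∀ x ∈ X, ∀ x' ∈ X,
      ‖gradient (fun z => f (z, y)) x - gradient (fun z => f (z, y)) x'‖ ≤ L * ‖x - x'‖)
    (hsmooth_yy : ∀ x ∈ X, ∀ y ∈ Y, ∀ y' ∈ Y,
      ‖gradient (fun w => f (x, w)) y - gradient (fun w => f (x, w)) y'‖ ≤ L * ‖y - y'‖)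
    (hsmooth_xy : ∀ x ∈ X, ∀ y ∈ Y, ∀ y' ∈ Y,
      ‖gradient (fun z => f (z, y)) x - gradient (fun z => f (z, y')) x‖ ≤ L * ‖y - y'‖)
    (hsmooth_yx : ∀ y ∈ Y, ∀ x ∈ X, ∀ x' ∈ X,
      ‖gradient (fun w => f (x, w)) y - gradient (fun w => f (x', w)) y‖ ≤ L * ‖x - x'‖)
    (hgradbdd : ∀ x ∈ X, ∀ y ∈ Y,
      ‖gradient (fun z => f (z, y)) x‖ ≤ M ∧ ‖gradient (fun w => f (x, w)) y‖ ≤ M)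
    (xstar : E₁) (ystar : E₂) (hxstar : xstar ∈ X) (hystar : ystar ∈ Y)
    (hsaddle : ∀ x ∈ X, ∀ y ∈ Y, f (xstar, y) ≤ f (xstar, ystar) ∧ f (xstar, ystar) ≤ f (x, ystar))
    (η : ℝ) (hη : η = 1 / (4 * L))
    (R : ℝ) (ε : ℝ) (hε : 0 < ε) (T : ℕ) (hT : 0 < T)
    (x xt xts xns : ℕ → E₁) (y yt yts yns : ℕ → E₂)
    (hx1 : x 1 ∈ X) (hy1 : y 1 ∈ Y)
    (hR : R = ‖x 1 - xstar‖ + ‖y 1 - ystar‖)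
    (εx εy : ℕ → ℝ) (hεnn : ∀ t ∈ Finset.Icc 1 T, 0 ≤ εx t ∧ 0 ≤ εy t)
    (hprec : ∀ t ∈ Finset.Icc 1 T,
      2 * η * max (εx t) (εy t) < 1 / 4 ∧
      (2 * η * max (εx t) (εy t)) / (1 - 4 * (2 * η * max (εx t) (εy t)))
          * (9 + 8 * η ^ 2 * L ^ 2 + ((t : ℝ) + 1) ^ 2 * (4 + 12 * η * M ^ 2 / ε))
        + 5 * (2 * η * max (εx t) (εy t)) ≤ 1 / 4)
    (hmem : ∀ t ∈ Finset.Icc 1 T, xt t ∈ X ∧ yt t ∈ Y ∧ x (t + 1) ∈ X ∧ y (t + 1) ∈ Y)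
    (hxts : ∀ t ∈ Finset.Icc 1 T, xts t ∈ X ∧
      IsMinOn (fun z => f (z, y t) + 1 / (2 * η) * ‖z - x t‖ ^ 2) X (xts t))
    (hyts : ∀ t ∈ Finset.Icc 1 T, yts t ∈ Y ∧
      IsMaxOn (fun w => f (x t, w) - 1 / (2 * η) * ‖w - y t‖ ^ 2) Y (yts t))
    (hxns : ∀ t ∈ Finset.Icc 1 T, xns (t + 1) ∈ X ∧
      IsMinOn (fun z => f (z, yt t) + 1 / (2 * η) * ‖z - x t‖ ^ 2) X (xns (t + 1)))
    (hyns : ∀ t ∈ Finset.Icc 1 T, yns (t + 1) ∈ Y ∧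
      IsMaxOn (fun w => f (xt t, w) - 1 / (2 * η) * ‖w - y t‖ ^ 2) Y (yns (t + 1)))
    (hin1 : ∀ t ∈ Finset.Icc 1 T,
      f (xt t, y t) + 1 / (2 * η) * ‖xt t - x t‖ ^ 2
        ≤ f (xts t, y t) + 1 / (2 * η) * ‖xts t - x t‖ ^ 2 + εx t * ‖x t - xts t‖ ^ 2)
    (hin2 : ∀ t ∈ Finset.Icc 1 T,
      -f (x t, yt t) + 1 / (2 * η) * ‖yt t - y t‖ ^ 2
        ≤ -f (x t, yts t) + 1 / (2 * η) * ‖yts t - y t‖ ^ 2 + εy t * ‖y t - yts t‖ ^ 2)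
    (hin3 : ∀ t ∈ Finset.Icc 1 T,
      f (x (t + 1), yt t) + 1 / (2 * η) * ‖x (t + 1) - x t‖ ^ 2
        ≤ f (xns (t + 1), yt t) + 1 / (2 * η) * ‖xns (t + 1) - x t‖ ^ 2
          + εx t * ‖x t - xns (t + 1)‖ ^ 2)
    (hin4 : ∀ t ∈ Finset.Icc 1 T,
      -f (xt t, y (t + 1)) + 1 / (2 * η) * ‖y (t + 1) - y t‖ ^ 2
        ≤ -f (xt t, yns (t + 1)) + 1 / (2 * η) * ‖yns (t + 1) - y t‖ ^ 2
          + εy t * ‖y t - yns (t + 1)‖ ^ 2) :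
    f ((T : ℝ)⁻¹ • ∑ t ∈ Finset.Icc 1 T, xt t, ystar)
        - f (xstar, (T : ℝ)⁻¹ • ∑ t ∈ Finset.Icc 1 T, yt t)
      ≤ 4 * L * R ^ 2 / T + ε / 2
    ∧ ((T : ℝ) ≥ 8 * L * R ^ 2 / ε →
        f ((T : ℝ)⁻¹ • ∑ t ∈ Finset.Icc 1 T, xt t, ystar)
            - f (xstar, (T : ℝ)⁻¹ • ∑ t ∈ Finset.Icc 1 T, yt t) ≤ ε) := by
  have hη2 : 1 / (2 * η) = 2 * L := by rw [hη]; field_simp; norm_num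
  have hηpos : 0 < η := by rw [hη]; positivity
  rw [hη2] at hxts hyts hxns hyns hin1 hin2 hin3 hin4
  have hxy : ∀ t ∈ Finset.Icc 1 T, x t ∈ X ∧ y t ∈ Y := by
    intro t ht
    rw [Finset.mem_Icc] at ht
    obtain ⟨s, rfl⟩ : ∃ s, t = s + 1 := ⟨t - 1, by omega⟩
    rcases Nat.eq_zero_or_pos s with rfl | hs
    · exact ⟨hx1, hy1⟩
    · exact (hmem s (Finset.mem_Icc.2 ⟨hs, by omega⟩)).2.2
  have hdx : ∀ b, Differentiable ℝ (fun z => f (z, b)) := fun b => by fun_prop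
  have hdy : ∀ a, Differentiable ℝ (fun w => f (a, w)) := fun a => by fun_prop
  have hneg : ∀ b : E₁, ∀ w, gradient (fun w => -f (b, w)) w = -gradient (fun w => f (b, w)) w := by
    intro b w
    simp [gradient, fderiv_fun_neg]
  have hstep : ∀ t ∈ Finset.Icc 1 T, f (xt t, ystar) - f (xstar, yt t)
      ≤ 2 * L * (‖x t - xstar‖ ^ 2 + ‖y t - ystar‖ ^ 2)
        - (1 - 1 / ((t : ℝ) + 1) ^ 2)
          * (2 * L * (‖x (t + 1) - xstar‖ ^ 2 + ‖y (t + 1) - ystar‖ ^ 2)) := by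
    intro t ht
    obtain ⟨hxtX, hytY, hxnX, hynY⟩ := hmem t ht
    obtain ⟨hxX, hyY⟩ := hxy t ht
    obtain ⟨hd1, hd2⟩ := hprec t ht
    have hδ0 : 0 ≤ 2 * η * max (εx t) (εy t) :=
      mul_nonneg (by positivity) ((hεnn t ht).1.trans (le_max_left _ _))
    have hee : max (εx t) (εy t) = 2 * L * (2 * η * max (εx t) (εy t)) := by
      rw [hη]; field_simp; norm_num
    generalize 2 * η * max (εx t) (εy t) = δ at hd1 hd2 hδ0 hee
    have hk4 : (4 : ℝ) ≤ ((t : ℝ) + 1) ^ 2 := by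
      have : (1 : ℝ) ≤ t := by exact_mod_cast (Finset.mem_Icc.1 ht).1
      nlinarith
    have hδk : δ * (9 + ((t : ℝ) + 1) ^ 2 * 4) ≤ 1 / 4 := by
      refine le_trans ?_ hd2
      have hle : δ ≤ δ / (1 - 4 * δ) := by
        rw [le_div_iff₀ (by linarith)]; nlinarith
      have hfac : 9 + ((t : ℝ) + 1) ^ 2 * 4
          ≤ 9 + 8 * η ^ 2 * L ^ 2 + ((t : ℝ) + 1) ^ 2 * (4 + 12 * η * M ^ 2 / ε) := by
        have h1 : 0 ≤ 8 * η ^ 2 * L ^ 2 := by positivity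
        have h2 : 0 ≤ ((t : ℝ) + 1) ^ 2 * (12 * η * M ^ 2 / ε) := by positivity
        linarith
      have := mul_le_mul hle hfac (by positivity) (hδ0.trans hle)
      linarith
    have hδ : δ ≤ 1 / 100 := by nlinarith
    have hkδ : ((t : ℝ) + 1) ^ 2 * δ ≤ 1 / 16 := by linarith
    have hbx := inexact_optimistic_step (hconv _ hyY) (hconv _ hytY) hL
      hδ (by linarith : 1 < ((t : ℝ) + 1) ^ 2) hkδ
      (hee ▸ le_max_left (εx t) (εy t)) hxtX (hxts t ht).1 hxnX (hxns t ht).1 hxstar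
      (hxts t ht).2 (hxns t ht).2 (hin1 t ht) (hin3 t ht) (norm_nonneg (yt t - y t))
      (sub_sub_sub_le_of_norm_gradient_sub_le hXconv (hdx _) (hdx _)
        (fun z hz => hsmooth_xy z hz _ hytY _ hyY) hxtX hxnX)
    have hby := inexact_optimistic_step (hconc _ hxX).neg (hconc _ hxtX).neg hL
      hδ (by linarith : 1 < ((t : ℝ) + 1) ^ 2) hkδ
      (hee ▸ le_max_right (εx t) (εy t)) hytY (hyts t ht).1 hynY (hyns t ht).1 hystar
      (isMinOn_iff.2 fun w hw => by
        have := isMaxOn_iff.1 (hyts t ht).2 w hw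
        simp only [Pi.neg_apply]
        linarith)
      (isMinOn_iff.2 fun w hw => by
        have := isMaxOn_iff.1 (hyns t ht).2 w hw
        simp only [Pi.neg_apply]
        linarith)
      (hin2 t ht) (hin4 t ht) (norm_nonneg (xt t - x t))
      (sub_sub_sub_le_of_norm_gradient_sub_le hYconv (hdy (xt t)).fun_neg (hdy (x t)).fun_neg
        (fun w hw => by
          rw [hneg, hneg, neg_sub_neg, norm_sub_rev]
          exact hsmooth_yx w hw _ hxtX _ hxX) hytY hynY)
    simp only [Pi.neg_apply] at hby
    linarith
  have hsum := sum_le_two_mul_of_quasi_telescope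
    (Φ := fun t => 2 * L * (‖x t - xstar‖ ^ 2 + ‖y t - ystar‖ ^ 2))
    (fun t => by positivity)
    (fun t ht => by
      obtain ⟨hxtX, hytY, -, -⟩ := hmem t ht
      linarith [(hsaddle _ hxtX _ hytY).1, (hsaddle _ hxtX _ hytY).2]) hstep
  have hTpos : (0 : ℝ) < T := by exact_mod_cast hT
  have hw1 : ∑ _t ∈ Finset.Icc 1 T, (T : ℝ)⁻¹ = 1 := by
    simp [hTpos.ne']
  have hjx := (hconv _ hystar).map_sum_le (t := Finset.Icc 1 T) (w := fun _ => (T : ℝ)⁻¹) (p := xt)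
    (fun _ _ => by positivity) hw1 (fun t ht => (hmem t ht).1)
  have hjy := (hconc _ hxstar).le_map_sum (t := Finset.Icc 1 T) (w := fun _ => (T : ℝ)⁻¹) (p := yt)
    (fun _ _ => by positivity) hw1 (fun t ht => (hmem t ht).2.1)
  simp only [← Finset.smul_sum, smul_eq_mul, ← Finset.mul_sum] at hjx hjy
  have hmain : f ((T : ℝ)⁻¹ • ∑ t ∈ Finset.Icc 1 T, xt t, ystar)
        - f (xstar, (T : ℝ)⁻¹ • ∑ t ∈ Finset.Icc 1 T, yt t) ≤ 4 * L * R ^ 2 / T := by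
    have hR2 : ‖x 1 - xstar‖ ^ 2 + ‖y 1 - ystar‖ ^ 2 ≤ R ^ 2 := by
      rw [hR]
      nlinarith [mul_nonneg (norm_nonneg (x 1 - xstar)) (norm_nonneg (y 1 - ystar))]
    have hS : ∑ t ∈ Finset.Icc 1 T, (f (xt t, ystar) - f (xstar, yt t)) ≤ 4 * L * R ^ 2 := by
      refine hsum.trans ?_
      have := mul_le_mul_of_nonneg_left hR2 hL.le
      linarith
    rw [Finset.sum_sub_distrib] at hS
    have := mul_le_mul_of_nonneg_left hS (inv_nonneg.2 hTpos.le)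
    rw [div_eq_inv_mul]
    linarith
  refine ⟨by linarith, fun hTge => ?_⟩
  rw [ge_iff_le, div_le_iff₀ hε] at hTge
  refine hmain.trans ?_
  rw [div_le_iff₀ hTpos]
  nlinarith [mul_nonneg hL.le (sq_nonneg R)]
end

section
/- Let E₁, E₂ be finite-dimensional real inner product spaces, X ⊆ E₁ and Y ⊆ E₂ compact convex sets, 0 < μ ≤ L, M ≥ 0, and let f : E₁ × E₂ → ℝ be differentiable, L-smooth on X × Y, with f(·,y) μ-strongly convex on X for every y ∈ Y and f(x,·) μ-strongly concave on Y for every x ∈ X, and ‖∇_x f(x,y)‖ ≤ M, ‖∇_y f(x,y)‖ ≤ M on X × Y. Let (x*, y*) ∈ X × Y be a saddle point of f on X × Y, set η := 1/(4L), fix (x_1, y_1) ∈ X × Y, let R := ‖x_1 − x*‖ + ‖y_1 − y*‖, and let ε > 0. Let (x_t, y_t, x̃_t, ỹ_t)_{t=1}^{T} be a RIODA trajectory on X × Y with step η and tolerances (ε_t^x, ε_t^y) satisfying, for every t: ε̄_t := 2η·max{ε_t^x, ε_t^y} < 1/4 and (ε̄_t/(1 − 4ε̄_t))·(9 + 8η²L²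 + max{(t+1)², 16L/μ}·(4 + 8ηM²/ε)) + 5ε̄_t ≤ 1/4. Then for every positive integer T with T ≥ 1 + (17L/μ)·log(4LR²/ε), the last iterates satisfy f(x̃_T, y*) − f(x*, ỹ_T) ≤ ε. -/
/-- Quadratic growth of a proximal objective around its minimizer. -/
lemma prox_growth {E : Type*} [NormedAddCommGroup E] [InnerProductSpace ℝ E]
    {X : Set E} {g : E → ℝ} {μ η : ℝ}
    (hg : ConvexOn ℝ X (fun z => g z - μ / 2 * ‖z‖ ^ 2)) {a v u : E} (hv : v ∈ X) (hu : u ∈ X)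
    (hmin : IsMinOn (fun z => g z + 1 / (2 * η) * ‖z - a‖ ^ 2) X v) :
    g v + 1 / (2 * η) * ‖v - a‖ ^ 2 + (μ / 2 + 1 / (2 * η)) * ‖u - v‖ ^ 2
      ≤ g u + 1 / (2 * η) * ‖u - a‖ ^ 2 := by
  have key : ∀ t : ℝ, 0 < t → t < 1 →
      (1 - t) * ((μ / 2 + 1 / (2 * η)) * ‖u - v‖ ^ 2)
        ≤ g u + 1 / (2 * η) * ‖u - a‖ ^ 2 - (g v + 1 / (2 * η) * ‖v - a‖ ^ 2) := by
    intro t ht0 ht1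
    have hmem : (1 - t) • v + t • u ∈ X := hg.1 hv hu (by linarith) ht0.le (by ring)
    have h1 := hg.2 hv hu (by linarith : 0 ≤ 1 - t) ht0.le (by ring)
    have h2 := isMinOn_iff.1 hmin _ hmem
    simp only [smul_eq_mul] at h1 h2
    have segment_norm_sq : ∀ b c : E, ‖(1 - t) • b + t • c‖ ^ 2
        = (1 - t) * ‖b‖ ^ 2 + t * ‖c‖ ^ 2 - t * (1 - t) * ‖c - b‖ ^ 2 := by
      intro b c
      rw [norm_add_sq_real, norm_sub_sq_real, norm_smul, norm_smul, real_inner_smul_left,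
        real_inner_smul_right, mul_pow, mul_pow, Real.norm_eq_abs, Real.norm_eq_abs, sq_abs,
        sq_abs, real_inner_comm b c]
      ring
    have e2 : (1 - t) • v + t • u - a = (1 - t) • (v - a) + t • (u - a) := by module
    have n2 := segment_norm_sq (v - a) (u - a)
    rw [← e2, sub_sub_sub_cancel_right] at n2
    rw [n2] at h2
    rw [segment_norm_sq v u] at h1
    refine le_of_mul_le_mul_left ?_ ht0
    linarith
  refine sub_nonneg.1 ?_
  set A := (μ / 2 + 1 / (2 * η)) * ‖u - v‖ ^ 2
  have hlim : Filter.Tendsto (fun t : ℝ => (1 - t) * A) (nhdsWithin 0 (Set.Ioi 0)) (nhds A) := by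
    have : Continuous (fun t : ℝ => (1 - t) * A) := by fun_prop
    simpa using (this.tendsto 0).mono_left nhdsWithin_le_nhds
  have hle := le_of_tendsto hlim (Filter.mem_of_superset
    (Ioo_mem_nhdsGT (zero_lt_one' ℝ)) fun t ht => key t ht.1 ht.2)
  linarith

/-- An approximate proximal point satisfies the proximal inequality of the exact point `v`, and its
distance to `v` is controlled by its distance to the prox centre. -/
lemma inexact_prox_growth {E : Type*} [NormedAddCommGroup E] [InnerProductSpace ℝ E]
    {X : Set E} {g : E → ℝ} {μ η e : ℝ} (hμ : 0 ≤ μ) (hη : 0 < η)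
    (he0 : 0 ≤ e) (he : 2 * η * e ≤ 1 / 256)
    (hg : ConvexOn ℝ X (fun z => g z - μ / 2 * ‖z‖ ^ 2)) {a v q : E} (hv : v ∈ X) (hq : q ∈ X)
    (hmin : IsMinOn (fun z => g z + 1 / (2 * η) * ‖z - a‖ ^ 2) X v)
    (hin : g q + 1 / (2 * η) * ‖q - a‖ ^ 2
      ≤ g v + 1 / (2 * η) * ‖v - a‖ ^ 2 + e * ‖a - v‖ ^ 2) :
    (∀ u ∈ X, 2 * η * (g q - g u) ≤ ‖u - a‖ ^ 2 - ‖q - a‖ ^ 2 - (1 + μ * η) * ‖u - v‖ ^ 2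
        + 2 * η * e * (7 / 5 * ‖q - a‖ ^ 2)) ∧
      ‖q - v‖ ^ 2 ≤ 2 * η * e * (7 / 5 * ‖q - a‖ ^ 2) := by
  have hη2 : 0 < 2 * η := by positivity
  have hc : 2 * η * (1 / (2 * η)) = 1 := by field_simp
  have growth : ∀ u ∈ X, 2 * η * (g v) + ‖v - a‖ ^ 2 + (1 + μ * η) * ‖u - v‖ ^ 2
      ≤ 2 * η * g u + ‖u - a‖ ^ 2 := by
    intro u hu
    have h := mul_le_mul_of_nonneg_left (prox_growth hg hv hu hmin) hη2.le
    linear_combination h + (‖u - a‖ ^ 2 - ‖v - a‖ ^ 2 - ‖u - v‖ ^ 2) * hc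
  have hin' : 2 * η * g q + ‖q - a‖ ^ 2
      ≤ 2 * η * g v + ‖v - a‖ ^ 2 + 2 * η * e * ‖a - v‖ ^ 2 := by
    have h := mul_le_mul_of_nonneg_left hin hη2.le
    linear_combination h + (‖v - a‖ ^ 2 - ‖q - a‖ ^ 2) * hc
  have hδ0 : 0 ≤ 2 * η * e := by positivity
  have hm : 0 ≤ μ * η := by positivity
  have hqv : ‖q - v‖ ^ 2 ≤ 2 * η * e * ‖a - v‖ ^ 2 := by
    have := growth q hq
    nlinarith [mul_nonneg hm (sq_nonneg ‖q - v‖)]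
  have htri : ‖a - v‖ ^ 2 ≤ 4 / 3 * ‖q - a‖ ^ 2 + 4 * ‖q - v‖ ^ 2 := by
    have h : ‖a - v‖ ≤ ‖q - a‖ + ‖q - v‖ := by
      simpa [norm_sub_rev q a] using norm_sub_le_norm_sub_add_norm_sub a q v
    nlinarith [sq_nonneg (‖q - a‖ - 3 * ‖q - v‖), norm_nonneg (a - v)]
  have hav : ‖a - v‖ ^ 2 ≤ 7 / 5 * ‖q - a‖ ^ 2 := by
    nlinarith [mul_le_mul_of_nonneg_right he (sq_nonneg ‖a - v‖), sq_nonneg ‖q - a‖]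
  have hδ := mul_le_mul_of_nonneg_left hav hδ0
  refine ⟨fun u hu => ?_, hqv.trans hδ⟩
  have := growth u hu
  linarith

lemma sub_sub_sub_le_of_gradient_sub_le {E : Type*} [NormedAddCommGroup E] [InnerProductSpace ℝ E]
    [CompleteSpace E] {X : Set E} (hX : Convex ℝ X) {g h : E → ℝ} (hg : Differentiable ℝ g)
    (hh : Differentiable ℝ h) {C : ℝ} (hC : ∀ z ∈ X, ‖gradient g z - gradient h z‖ ≤ C)
    {p q : E} (hp : p ∈ X) (hq : q ∈ X) :
    (g p - h p) - (g q - h q) ≤ C * ‖p - q‖ := by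
  have hb : ∀ z ∈ X, ‖fderiv ℝ (fun z => g z - h z) z‖ ≤ C := by
    intro z hz
    rw [fderiv_fun_sub (hg z) (hh z)]
    simpa [gradient, ← map_sub] using hC z hz
  exact (Real.le_norm_self _).trans
    (hX.norm_image_sub_le_of_norm_fderiv_le (fun z _ => (hg.sub hh) z) hb hq hp)

/-- One block of an inexact optimistic (extragradient) proximal step: `p` is the prediction made
with `g₀`, and `q` the correction made with `g₁`, whose gradients differ by at most `L * b`. -/
lemma optimistic_block_step {E : Type*} [NormedAddCommGroup E] [InnerProductSpace ℝ E]
    [CompleteSpace E] {X : Set E} {g₀ g₁ : E → ℝ} {μ η e L b : ℝ} (hμ : 0 < μ) (hη : 0 < η)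
    (hL : η * L = 1 / 4) (hm : μ * η ≤ 1 / 4) (he0 : 0 ≤ e) (he : 2 * η * e ≤ μ * η / 64)
    (hd₀ : Differentiable ℝ g₀) (hd₁ : Differentiable ℝ g₁)
    (hg₀ : ConvexOn ℝ X (fun z => g₀ z - μ / 2 * ‖z‖ ^ 2))
    (hg₁ : ConvexOn ℝ X (fun z => g₁ z - μ / 2 * ‖z‖ ^ 2))
    (hgrad : ∀ z ∈ X, ‖gradient g₁ z - gradient g₀ z‖ ≤ L * b)
    {a p ps q qs u : E} (hp : p ∈ X) (hps : ps ∈ X) (hq : q ∈ X) (hqs : qs ∈ X) (hu : u ∈ X)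
    (hminp : IsMinOn (fun z => g₀ z + 1 / (2 * η) * ‖z - a‖ ^ 2) X ps)
    (hminq : IsMinOn (fun z => g₁ z + 1 / (2 * η) * ‖z - a‖ ^ 2) X qs)
    (hinp : g₀ p + 1 / (2 * η) * ‖p - a‖ ^ 2
      ≤ g₀ ps + 1 / (2 * η) * ‖ps - a‖ ^ 2 + e * ‖a - ps‖ ^ 2)
    (hinq : g₁ q + 1 / (2 * η) * ‖q - a‖ ^ 2
      ≤ g₁ qs + 1 / (2 * η) * ‖qs - a‖ ^ 2 + e * ‖a - qs‖ ^ 2) :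
    2 * η * (g₁ p - g₁ u) ≤ ‖u - a‖ ^ 2 - (1 + μ * η / 4) * ‖u - q‖ ^ 2
      - 1 / 4 * ‖p - a‖ ^ 2 + 1 / 4 * b ^ 2 := by
  obtain ⟨hp1, hp2⟩ := inexact_prox_growth hμ.le hη he0 (by linarith) hg₀ hps hp hminp hinp
  obtain ⟨hq1, hq2⟩ := inexact_prox_growth hμ.le hη he0 (by linarith) hg₁ hqs hq hminq hinq
  specialize hp1 q hq
  specialize hq1 u hu
  have hcross := sub_sub_sub_le_of_gradient_sub_le hg₀.1 hd₁ hd₀ hgrad hp hq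
  have hm0 : 0 < μ * η := by positivity
  have htri : ‖q - a‖ ^ 2 ≤ 2 * ‖p - a‖ ^ 2 + 2 * ‖p - q‖ ^ 2 := by
    have h : ‖q - a‖ ≤ ‖p - q‖ + ‖p - a‖ := by
      simpa [norm_sub_rev q p] using norm_sub_le_norm_sub_add_norm_sub q p a
    nlinarith [sq_nonneg (‖p - q‖ - ‖p - a‖), norm_nonneg (q - a)]
  have htrip : ‖p - q‖ ^ 2 ≤ 2 * ‖q - ps‖ ^ 2 + 2 * ‖p - ps‖ ^ 2 := by
    have h : ‖p - q‖ ≤ ‖p - ps‖ + ‖q - ps‖ := by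
      simpa [norm_sub_rev q ps] using norm_sub_le_norm_sub_add_norm_sub p ps q
    nlinarith [sq_nonneg (‖q - ps‖ - ‖p - ps‖), norm_nonneg (p - q)]
  generalize μ * η = m at *
  have hyoung : m * ‖u - q‖ ^ 2 ≤ m * ((1 + m / 4) * ‖u - qs‖ ^ 2) + (m + 4) * ‖q - qs‖ ^ 2 := by
    have h : ‖u - q‖ ≤ ‖u - qs‖ + ‖q - qs‖ := by
      simpa [norm_sub_rev q qs] using norm_sub_le_norm_sub_add_norm_sub u qs q
    have h2 : ‖u - q‖ ^ 2 ≤ (‖u - qs‖ + ‖q - qs‖) ^ 2 := by gcongr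
    linear_combination 1 / 4 * sq_nonneg (m * ‖u - qs‖ - 4 * ‖q - qs‖) + m * h2
  have hδp : 2 * η * e * (7 / 5 * ‖p - a‖ ^ 2) ≤ m / 64 * (7 / 5 * ‖p - a‖ ^ 2) := by gcongr
  have hδq : 2 * η * e * (7 / 5 * ‖q - a‖ ^ 2) ≤ m / 64 * (7 / 5 * ‖q - a‖ ^ 2) := by gcongr
  have hmp : m * ‖p - a‖ ^ 2 ≤ 1 / 4 * ‖p - a‖ ^ 2 := by gcongr
  have hmq : m * ‖q - a‖ ^ 2 ≤ 1 / 4 * ‖q - a‖ ^ 2 := by gcongr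
  have hq3 : (m + 4) * ‖q - qs‖ ^ 2 ≤ m * (47 / 500 * ‖q - a‖ ^ 2) := by
    have h1 : (m + 4) * ‖q - qs‖ ^ 2 ≤ (17 / 4) * ‖q - qs‖ ^ 2 := by gcongr; linarith
    linear_combination h1 + 17 / 4 * (hq2.trans hδq) +
      33 / 32000 * mul_nonneg hm0.le (sq_nonneg ‖q - a‖)
  have hq4 : ‖u - q‖ ^ 2 ≤ (1 + m / 4) * ‖u - qs‖ ^ 2 + 47 / 500 * ‖q - a‖ ^ 2 := by
    refine le_of_mul_le_mul_left ?_ hm0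
    linarith
  have hq5 : (1 + m / 4) * ‖u - q‖ ^ 2 ≤ (1 + m) * ‖u - qs‖ ^ 2 + 1 / 10 * ‖q - a‖ ^ 2 := by
    have h1 := mul_le_mul_of_nonneg_left hq4 (by linarith : 0 ≤ 1 + m / 4)
    have h2 : (1 + m / 4) * (1 + m / 4) * ‖u - qs‖ ^ 2 ≤ (1 + m) * ‖u - qs‖ ^ 2 := by
      gcongr
      linarith [mul_le_mul_of_nonneg_left hm hm0.le]
    linarith [sq_nonneg ‖q - a‖]
  have hcross' : 2 * η * ((g₁ p - g₀ p) - (g₁ q - g₀ q)) ≤ 1 / 4 * b ^ 2 + 1 / 4 * ‖p - q‖ ^ 2 := by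
    have h := mul_le_mul_of_nonneg_left hcross (by positivity : 0 ≤ 2 * η)
    have h2 : 2 * η * (L * b * ‖p - q‖) = 1 / 2 * (b * ‖p - q‖) := by
      linear_combination 2 * b * ‖p - q‖ * hL
    linear_combination h + h2 + 1 / 4 * sq_nonneg (b - ‖p - q‖)
  linarith [mul_nonneg hm0.le (sq_nonneg ‖q - ps‖), sq_nonneg ‖p - a‖, sq_nonneg ‖p - q‖]

lemma le_of_geometric_decay {L μ η ε R d₁ d : ℝ} {n : ℕ} (hμ : 0 < μ) (hμL : μ ≤ L)
    (hη : η = 1 / (4 * L)) (hε : 0 < ε) (hd₁ : d₁ ≤ R ^ 2)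
    (hd : (1 + μ * η / 4) ^ n * d ≤ d₁)
    (hn : 17 * L / μ * Real.log (4 * L * R ^ 2 / ε) ≤ n) :
    d ≤ ε / (4 * L) := by
  have hL : 0 < L := hμ.trans_le hμL
  have hη0 : 0 < η := by rw [hη]; positivity
  have hρ : 0 < 1 + μ * η / 4 := by positivity
  rcases eq_or_ne R 0 with rfl | hR
  · have : d ≤ 0 := by
      by_contra! h
      have : 0 < (1 + μ * η / 4) ^ n * d := by positivity
      norm_num at hd₁
      linarith
    exact this.trans (by positivity)
  have hR2 : 0 < R ^ 2 := by positivity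
  have hpos : 0 < 4 * L * R ^ 2 / ε := by positivity
  have hlog : μ / (17 * L) ≤ Real.log (1 + μ * η / 4) := by
    refine le_trans ?_ (Real.one_sub_inv_le_log_of_pos hρ)
    have : 1 - (1 + μ * η / 4)⁻¹ = μ / (16 * L + μ) := by
      rw [hη]
      field_simp
      ring
    rw [this]
    gcongr
    linarith
  have hexp : 4 * L * R ^ 2 / ε ≤ (1 + μ * η / 4) ^ n := by
    rw [← Real.log_le_log_iff hpos (by positivity), Real.log_pow]
    calc Real.log (4 * L * R ^ 2 / ε)
        = 17 * L / μ * Real.log (4 * L * R ^ 2 / ε) * (μ / (17 * L)) := by field_simp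
      _ ≤ n * (μ / (17 * L)) := by gcongr
      _ ≤ n * Real.log (1 + μ * η / 4) := by gcongr
  rcases le_or_gt d 0 with h0 | h0
  · exact h0.trans (by positivity)
  have h := (mul_le_mul_of_nonneg_right hexp h0.le).trans (hd.trans hd₁)
  rw [div_mul_eq_mul_div, div_le_iff₀ hε] at h
  rw [le_div_iff₀ (by positivity)]
  refine le_of_mul_le_mul_left ?_ hR2
  linarith

lemma tolerance_le_of_precision {δ c s κ M' : ℝ} (hc : 0 ≤ c) (hM' : 0 ≤ M') (hκ : 0 ≤ κ)
    (hδ0 : 0 ≤ δ) (hδ : δ < 1 / 4)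
    (h : δ / (1 - 4 * δ) * (c + max s (16 * κ) * (4 + M')) + 5 * δ ≤ 1 / 4) :
    δ * κ ≤ 1 / 256 := by
  have h1 : δ ≤ δ / (1 - 4 * δ) := by
    rw [le_div_iff₀ (by linarith)]
    nlinarith
  have h2 : 64 * κ ≤ c + max s (16 * κ) * (4 + M') := by
    nlinarith [le_max_right s (16 * κ), mul_nonneg (hκ.trans (by linarith [le_max_right s (16 * κ)] :
      κ ≤ max s (16 * κ))) hM']
  have h3 : δ * (64 * κ) ≤ δ / (1 - 4 * δ) * (c + max s (16 * κ) * (4 + M')) := by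
    gcongr
    exact hδ0.trans h1
  linarith

/-- **RIODA, strongly convex-concave case (constrained), Euclidean instance.** Theorem 3.1 of
"Implicit Riemannian Optimism with Applications to Min-Max Problems". -/
theorem rioda_strongly_convex_concave
    {E₁ E₂ : Type*}
    [NormedAddCommGroup E₁] [InnerProductSpace ℝ E₁] [FiniteDimensional ℝ E₁]
    [NormedAddCommGroup E₂] [InnerProductSpace ℝ E₂] [FiniteDimensional ℝ E₂]
    (X : Set E₁) (Y : Set E₂)
    (hXcomp : IsCompact X) (hXconv : Convex ℝ X)
    (hYcomp : IsCompact Y) (hYconv : Convex ℝ Y)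
    (μ L : ℝ) (hμ : 0 < μ) (hμL : μ ≤ L) (M : ℝ) (hM : 0 ≤ M)
    (f : E₁ × E₂ → ℝ) (hdiff : Differentiable ℝ f)
    (hconv : ∀ y ∈ Y, ConvexOn ℝ X (fun x => f (x, y) - μ / 2 * ‖x‖ ^ 2))
    (hconc : ∀ x ∈ X, ConvexOn ℝ Y (fun y => -f (x, y) - μ / 2 * ‖y‖ ^ 2))
    (hsmooth_xx : ∀ y ∈ Y, ∀ x ∈ X, ∀ x' ∈ X,
      ‖gradient (fun z => f (z, y)) x - gradient (fun z => f (z, y)) x'‖ ≤ L * ‖x - x'‖)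
    (hsmooth_yy : ∀ x ∈ X, ∀ y ∈ Y, ∀ y' ∈ Y,
      ‖gradient (fun w => f (x, w)) y - gradient (fun w => f (x, w)) y'‖ ≤ L * ‖y - y'‖)
    (hsmooth_xy : ∀ x ∈ X, ∀ y ∈ Y, ∀ y' ∈ Y,
      ‖gradient (fun z => f (z, y)) x - gradient (fun z => f (z, y')) x‖ ≤ L * ‖y - y'‖)
    (hsmooth_yx : ∀ y ∈ Y, ∀ x ∈ X, ∀ x' ∈ X,
      ‖gradient (fun w => f (x, w)) y - gradient (fun w => f (x', w)) y‖ ≤ L * ‖x - x'‖)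
    (hgradbdd : ∀ x ∈ X, ∀ y ∈ Y,
      ‖gradient (fun z => f (z, y)) x‖ ≤ M ∧ ‖gradient (fun w => f (x, w)) y‖ ≤ M)
    (xstar : E₁) (ystar : E₂) (hxstar : xstar ∈ X) (hystar : ystar ∈ Y)
    (hsaddle : ∀ x ∈ X, ∀ y ∈ Y, f (xstar, y) ≤ f (xstar, ystar) ∧ f (xstar, ystar) ≤ f (x, ystar))
    (η : ℝ) (hη : η = 1 / (4 * L))
    (R : ℝ) (ε : ℝ) (hε : 0 < ε) (T : ℕ) (hT : 0 < T)
    (x xt xts xns : ℕ → E₁) (y yt yts yns : ℕ → E₂)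
    (hx1 : x 1 ∈ X) (hy1 : y 1 ∈ Y)
    (hR : R = ‖x 1 - xstar‖ + ‖y 1 - ystar‖)
    (εx εy : ℕ → ℝ) (hεnn : ∀ t ∈ Finset.Icc 1 T, 0 ≤ εx t ∧ 0 ≤ εy t)
    (hprec : ∀ t ∈ Finset.Icc 1 T,
      2 * η * max (εx t) (εy t) < 1 / 4 ∧
      (2 * η * max (εx t) (εy t)) / (1 - 4 * (2 * η * max (εx t) (εy t)))
          * (9 + 8 * η ^ 2 * L ^ 2
            + max (((t : ℝ) + 1) ^ 2) (16 * L / μ) * (4 + 8 * η * M ^ 2 / ε))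
        + 5 * (2 * η * max (εx t) (εy t)) ≤ 1 / 4)
    (hmem : ∀ t ∈ Finset.Icc 1 T, xt t ∈ X ∧ yt t ∈ Y ∧ x (t + 1) ∈ X ∧ y (t + 1) ∈ Y)
    (hxts : ∀ t ∈ Finset.Icc 1 T, xts t ∈ X ∧
      IsMinOn (fun z => f (z, y t) + 1 / (2 * η) * ‖z - x t‖ ^ 2) X (xts t))
    (hyts : ∀ t ∈ Finset.Icc 1 T, yts t ∈ Y ∧
      IsMaxOn (fun w => f (x t, w) - 1 / (2 * η) * ‖w - y t‖ ^ 2) Y (yts t))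
    (hxns : ∀ t ∈ Finset.Icc 1 T, xns (t + 1) ∈ X ∧
      IsMinOn (fun z => f (z, yt t) + 1 / (2 * η) * ‖z - x t‖ ^ 2) X (xns (t + 1)))
    (hyns : ∀ t ∈ Finset.Icc 1 T, yns (t + 1) ∈ Y ∧
      IsMaxOn (fun w => f (xt t, w) - 1 / (2 * η) * ‖w - y t‖ ^ 2) Y (yns (t + 1)))
    (hin1 : ∀ t ∈ Finset.Icc 1 T,
      f (xt t, y t) + 1 / (2 * η) * ‖xt t - x t‖ ^ 2
        ≤ f (xts t, y t) + 1 / (2 * η) * ‖xts t - x t‖ ^ 2 + εx t * ‖x t - xts t‖ ^ 2)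
    (hin2 : ∀ t ∈ Finset.Icc 1 T,
      -f (x t, yt t) + 1 / (2 * η) * ‖yt t - y t‖ ^ 2
        ≤ -f (x t, yts t) + 1 / (2 * η) * ‖yts t - y t‖ ^ 2 + εy t * ‖y t - yts t‖ ^ 2)
    (hin3 : ∀ t ∈ Finset.Icc 1 T,
      f (x (t + 1), yt t) + 1 / (2 * η) * ‖x (t + 1) - x t‖ ^ 2
        ≤ f (xns (t + 1), yt t) + 1 / (2 * η) * ‖xns (t + 1) - x t‖ ^ 2
          + εx t * ‖x t - xns (t + 1)‖ ^ 2)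
    (hin4 : ∀ t ∈ Finset.Icc 1 T,
      -f (xt t, y (t + 1)) + 1 / (2 * η) * ‖y (t + 1) - y t‖ ^ 2
        ≤ -f (xt t, yns (t + 1)) + 1 / (2 * η) * ‖yns (t + 1) - y t‖ ^ 2
          + εy t * ‖y t - yns (t + 1)‖ ^ 2)
    (hTlarge : (T : ℝ) ≥ 1 + 17 * L / μ * Real.log (4 * L * R ^ 2 / ε)) :
    f (xt T, ystar) - f (xstar, yt T) ≤ ε := by
  have hL : 0 < L := hμ.trans_le hμL
  have hη0 : 0 < η := by rw [hη]; positivity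
  have hηL : η * L = 1 / 4 := by rw [hη]; field_simp
  have hm : μ * η ≤ 1 / 4 := by nlinarith
  have hdx : ∀ v, Differentiable ℝ (fun z => f (z, v)) := fun v => by fun_prop
  have hdy : ∀ z, Differentiable ℝ (fun w => -f (z, w)) := fun z => by fun_prop
  have hgrad_neg : ∀ z w, gradient (fun w => -f (z, w)) w = -gradient (fun w => f (z, w)) w := by
    intro z w
    simp [gradient, fderiv_fun_neg]
  have hxy : ∀ t ∈ Finset.Icc 1 T, x t ∈ X ∧ y t ∈ Y := by
    intro t ht
    obtain ⟨h1, h2⟩ := Finset.mem_Icc.1 ht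
    obtain ⟨s, rfl⟩ := Nat.exists_eq_add_of_le' h1
    rcases Nat.eq_zero_or_pos s with rfl | hs
    · exact ⟨hx1, hy1⟩
    · exact (hmem s (Finset.mem_Icc.2 ⟨hs, by omega⟩)).2.2
  have htol : ∀ t ∈ Finset.Icc 1 T, 2 * η * max (εx t) (εy t) ≤ μ * η / 64 := by
    intro t ht
    obtain ⟨hδ, hp⟩ := hprec t ht
    have hmax : 0 ≤ max (εx t) (εy t) := (hεnn t ht).1.trans (le_max_left _ _)
    rw [mul_div_assoc 16 L μ] at hp
    have h := tolerance_le_of_precision (by positivity) (by positivity) (by positivity)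
      (by positivity) hδ hp
    have hκ : μ * η / 64 = 1 / 256 / (L / μ) := by
      rw [hη]
      field_simp
      norm_num
    rw [hκ, le_div_iff₀ (by positivity)]
    exact h
  have hstep : ∀ t ∈ Finset.Icc 1 T, 2 * η * (f (xt t, ystar) - f (xstar, yt t))
      + (1 + μ * η / 4) * (‖xstar - x (t + 1)‖ ^ 2 + ‖ystar - y (t + 1)‖ ^ 2)
      ≤ ‖xstar - x t‖ ^ 2 + ‖ystar - y t‖ ^ 2 := by
    intro t ht
    obtain ⟨hxtX, hytY⟩ := hxy t ht
    obtain ⟨hpX, hpY, hqX, hqY⟩ := hmem t ht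
    have hbx : 2 * η * εx t ≤ μ * η / 64 :=
      (mul_le_mul_of_nonneg_left (le_max_left _ _) (by positivity)).trans (htol t ht)
    have hby : 2 * η * εy t ≤ μ * η / 64 :=
      (mul_le_mul_of_nonneg_left (le_max_right _ _) (by positivity)).trans (htol t ht)
    have hX := optimistic_block_step (b := ‖yt t - y t‖) hμ hη0 hηL hm (hεnn t ht).1 hbx
      (hdx (y t)) (hdx (yt t)) (hconv _ hytY) (hconv _ hpY)
      (fun z hz => hsmooth_xy z hz _ hpY _ hytY) hpX (hxts t ht).1 hqX (hxns t ht).1 hxstar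
      (hxts t ht).2 (hxns t ht).2 (hin1 t ht) (hin3 t ht)
    have hminp : IsMinOn (fun w => -f (x t, w) + 1 / (2 * η) * ‖w - y t‖ ^ 2) Y (yts t) := by
      refine isMinOn_iff.2 fun w hw => ?_
      linarith [isMaxOn_iff.1 (hyts t ht).2 w hw]
    have hminq : IsMinOn (fun w => -f (xt t, w) + 1 / (2 * η) * ‖w - y t‖ ^ 2) Y
        (yns (t + 1)) := by
      refine isMinOn_iff.2 fun w hw => ?_
      linarith [isMaxOn_iff.1 (hyns t ht).2 w hw]
    have hY := optimistic_block_step (b := ‖xt t - x t‖) hμ hη0 hηL hm (hεnn t ht).2 hby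
      (hdy (x t)) (hdy (xt t)) (hconc _ hxtX) (hconc _ hpX)
      (fun w hw => by
        rw [hgrad_neg, hgrad_neg, neg_sub_neg, norm_sub_rev]
        exact hsmooth_yx w hw _ hpX _ hxtX) hpY (hyts t ht).1 hqY (hyns t ht).1 hystar
      hminp hminq (hin2 t ht) (hin4 t ht)
    linarith
  have hgap : ∀ t ∈ Finset.Icc 1 T, 0 ≤ f (xt t, ystar) - f (xstar, yt t) := by
    intro t ht
    obtain ⟨hpX, hpY, -, -⟩ := hmem t ht
    linarith [(hsaddle _ hpX _ hpY).1, (hsaddle _ hpX _ hpY).2]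
  have hdecay : ∀ n : ℕ, n + 1 ≤ T →
      (1 + μ * η / 4) ^ n * (‖xstar - x (n + 1)‖ ^ 2 + ‖ystar - y (n + 1)‖ ^ 2)
        ≤ ‖xstar - x 1‖ ^ 2 + ‖ystar - y 1‖ ^ 2 := by
    intro n
    induction n with
    | zero => intro _; simp
    | succ n ih =>
      intro hn
      have ht : n + 1 ∈ Finset.Icc 1 T := Finset.mem_Icc.2 ⟨by omega, by omega⟩
      refine le_trans ?_ (ih (by omega))
      rw [pow_succ, mul_assoc]
      gcongr
      have h2 : 0 ≤ 2 * η * (f (xt (n + 1), ystar) - f (xstar, yt (n + 1))) :=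
        mul_nonneg (by positivity) (hgap _ ht)
      linarith [hstep _ ht]
  obtain ⟨n, rfl⟩ : ∃ n, T = n + 1 := ⟨T - 1, by omega⟩
  have hT' : n + 1 ∈ Finset.Icc 1 (n + 1) := Finset.mem_Icc.2 ⟨by omega, le_rfl⟩
  have hd₁ : ‖xstar - x 1‖ ^ 2 + ‖ystar - y 1‖ ^ 2 ≤ R ^ 2 := by
    rw [hR, norm_sub_rev xstar, norm_sub_rev ystar]
    nlinarith [mul_nonneg (norm_nonneg (x 1 - xstar)) (norm_nonneg (y 1 - ystar))]
  have hfin := le_of_geometric_decay hμ hμL hη hε hd₁ (hdecay n le_rfl)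
    (by push_cast at hTlarge; linarith)
  have hlast := hstep _ hT'
  have hnn : 0 ≤ (1 + μ * η / 4) *
      (‖xstar - x (n + 1 + 1)‖ ^ 2 + ‖ystar - y (n + 1 + 1)‖ ^ 2) := by positivity
  have h2 : 2 * η * (f (xt (n + 1), ystar) - f (xstar, yt (n + 1))) ≤ η * ε := by
    have : ε / (4 * L) = η * ε := by rw [hη]; ring
    linarith
  have h3 := hgap _ hT'
  nlinarith
end

section
/- Let E₁, E₂ be finite-dimensional real inner product spaces, 0 < μ ≤ L, (x*, y*) ∈ E₁ × E₂, (x_1, y_1) ∈ E₁ × E₂ with R := ‖x_1 − x*‖ + ‖y_1 − y*‖ > 0, and let Z := B̄(x*, 8R) × B̄(y*, 8R) (closed balls). Let f : E₁ × E₂ → ℝ be differentiable and L-smooth on B̄(x*, 8R) × B̄(y*, 8R), with f(·,y) μ-strongly convex on B̄(x*, 8R) for every y ∈ B̄(y*, 8R), f(x,·) μ-strongly concave on B̄(y*, 8R) for every x ∈ B̄(x*, 8R), and f(x*, y) ≤ f(x*, y*) ≤ f(x, y*) for all (x, y) ∈ Z. Set η := 1/(4L) and ε_t := (L/8)·min{1,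 μ/(296L)}. Let (x_t, y_t, x̃_t, ỹ_t)_{t=1}^{T} be a RIODA trajectory on B̄(x*, 8R) × B̄(y*, 8R) with step η and tolerances ε_t^x = ε_t^y = ε_t. Then for all t: ‖x_{t+1} − x*‖² + ‖y_{t+1} − y*‖² ≤ (1 + μ/(16L))⁻¹·(‖x_t − x*‖² + ‖y_t − y*‖²), all iterates stay in Z, and for every ε > 0 and every positive integer T with T ≥ 1 + (17L/μ)·log(2LR²/ε), the last iterates satisfy f(x̃_T, y*) − f(x*, ỹ_T) ≤ ε. -/
/-- Quadratic growth of a strongly convex proximal objective at its minimizer. -/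
theorem prox_quadratic_growth {E : Type*} [NormedAddCommGroup E] [InnerProductSpace ℝ E]
    {X : Set E} {g : E → ℝ} {μ c : ℝ}
    (hg : ConvexOn ℝ X (fun z => g z - μ / 2 * ‖z‖ ^ 2)) {a p z : E} (hp : p ∈ X) (hz : z ∈ X)
    (hmin : IsMinOn (fun z => g z + c * ‖z - a‖ ^ 2) X p) :
    g p + c * ‖p - a‖ ^ 2 + (c + μ / 2) * ‖p - z‖ ^ 2 ≤ g z + c * ‖z - a‖ ^ 2 := by
  have comb : ∀ s : ℝ, ∀ u v : E, ‖(1 - s) • u + s • v‖ ^ 2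
      = (1 - s) * ‖u‖ ^ 2 + s * ‖v‖ ^ 2 - s * (1 - s) * ‖u - v‖ ^ 2 := by
    intro s u v
    rw [norm_add_sq_real, norm_sub_sq_real, norm_smul, norm_smul, inner_smul_left,
      inner_smul_right, mul_pow, mul_pow, Real.norm_eq_abs, Real.norm_eq_abs, sq_abs, sq_abs]
    simp only [conj_trivial]
    ring
  have key : ∀ s ∈ Set.Ioo (0 : ℝ) 1, (1 - s) * ((c + μ / 2) * ‖p - z‖ ^ 2)
      ≤ g z + c * ‖z - a‖ ^ 2 - (g p + c * ‖p - a‖ ^ 2) := by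
    rintro s ⟨h0, h1⟩
    have hw : (1 - s) • p + s • z ∈ X := hg.1 hp hz (by linarith) h0.le (by ring)
    have h2 := hg.2 hp hz (sub_nonneg.2 h1.le) h0.le (by ring)
    have h3 := isMinOn_iff.1 hmin _ hw
    have h4 : (1 - s) • p + s • z - a = (1 - s) • (p - a) + s • (z - a) := by module
    have h5 : p - a - (z - a) = p - z := by abel
    simp only [smul_eq_mul] at h2
    rw [comb] at h2
    rw [h4, comb, h5] at h3
    refine le_of_mul_le_mul_left ?_ h0
    linarith
  have hlim : Filter.Tendsto (fun s : ℝ => (1 - s) * ((c + μ / 2) * ‖p - z‖ ^ 2))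
      (nhdsWithin 0 (Set.Ioi 0)) (nhds ((1 - 0) * ((c + μ / 2) * ‖p - z‖ ^ 2))) :=
    (Continuous.tendsto (by fun_prop) 0).mono_left nhdsWithin_le_nhds
  have := le_of_tendsto hlim
    (Filter.eventually_of_mem (Ioo_mem_nhdsGT (zero_lt_one' ℝ)) key)
  linarith

/-- A difference of two differentiable functions whose gradients are `C`-close on a convex set
is `C`-Lipschitz on that set. -/
theorem sub_sub_sub_le_of_norm_gradient_sub_le_s6 {E : Type*} [NormedAddCommGroup E]
    [InnerProductSpace ℝ E] [CompleteSpace E] {X : Set E} (hX : Convex ℝ X) {g₀ g₁ : E → ℝ}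
    (hg₀ : Differentiable ℝ g₀) (hg₁ : Differentiable ℝ g₁) {C : ℝ}
    (hC : ∀ z ∈ X, ‖gradient g₁ z - gradient g₀ z‖ ≤ C) {z w : E} (hz : z ∈ X) (hw : w ∈ X) :
    (g₁ z - g₀ z) - (g₁ w - g₀ w) ≤ C * ‖z - w‖ := by
  refine (le_abs_self _).trans ?_
  refine hX.norm_image_sub_le_of_norm_hasFDerivWithin_le (f := fun z => g₁ z - g₀ z)
    (fun v _ => ((hg₁ v).hasFDerivAt.sub (hg₀ v).hasFDerivAt).hasFDerivWithinAt) ?_ hw hz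
  intro v hv
  have := hC v hv
  rwa [gradient, gradient, ← map_sub, LinearIsometryEquiv.norm_map] at this

/-- A perturbation `m` of size at most `μ / (4736 * L) * r ^ 2` in square costs a factor smaller
than the strong convexity gain. -/
theorem perturbed_sq_le {μ L k m n r : ℝ} (hμ : 0 < μ) (hμL : μ ≤ L) (k0 : 0 ≤ k)
    (hkmn : k ≤ m + n) (hm : L * m ^ 2 ≤ μ / 4736 * r ^ 2) :
    (2 * L + μ / 8) * k ^ 2 ≤ (2 * L + μ / 2) * n ^ 2 + L / 10 * r ^ 2 := by
  have hL : 0 < L := hμ.trans_le hμL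
  have hk : k ^ 2 ≤ (m + n) ^ 2 := by gcongr
  have hLμ := mul_le_mul_of_nonneg_left hk (show 0 ≤ 16 * L * μ by positivity)
  have hk' : 16 * L * μ * k ^ 2
      ≤ (16 * L * μ + μ ^ 2) * n ^ 2 + (16 * L * μ + (16 * L) ^ 2) * m ^ 2 := by
    linarith [sq_nonneg (μ * n - 16 * L * m)]
  have hm' : (16 * L * μ + (16 * L) ^ 2) * m ^ 2 ≤ 272 * L * (μ / 4736 * r ^ 2) := by
    have : (16 * L * μ + (16 * L) ^ 2) * m ^ 2 ≤ 272 * L * (L * m ^ 2) := by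
      linarith [mul_nonneg (mul_nonneg hL.le (sub_nonneg.2 hμL)) (sq_nonneg m)]
    exact this.trans (by gcongr)
  have hk'' : 16 * L * k ^ 2 ≤ (16 * L + μ) * n ^ 2 + 272 / 4736 * L * r ^ 2 := by
    refine le_of_mul_le_mul_left ?_ hμ
    linarith
  have h17 := mul_le_mul_of_nonneg_left hk'' (show 0 ≤ 16 * L + μ by positivity)
  refine le_of_mul_le_mul_left ?_ (show 0 < 128 * L by positivity)
  have q1 := mul_nonneg (mul_nonneg hL.le (sub_nonneg.2 hμL)) (sq_nonneg r)
  have q2 := mul_nonneg (mul_nonneg hμ.le (sub_nonneg.2 hμL)) (sq_nonneg n)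
  have q3 : 0 ≤ L * μ * n ^ 2 := by positivity
  have q4 : 0 ≤ L * L * r ^ 2 := by positivity
  linarith

/-- Scalar comparison of the side lengths between a point, its exact and inexact proximal points
and a further point, when the inexact one is relatively close to the exact one. -/
theorem prox_side_lengths_sq_le {a b c d p r : ℝ} (b0 : 0 ≤ b) (d0 : 0 ≤ d)
    (p0 : 0 ≤ p) (r0 : 0 ≤ r) (hb : 4736 * b ^ 2 ≤ p ^ 2) (hp : p ≤ a + b) (hd : d ≤ b + c)
    (hr : r ≤ p + c) :
    1 / 2368 * p ^ 2 + 1 / 2 * d ^ 2 + 1 / 10 * r ^ 2 ≤ 3 / 2 * a ^ 2 + 2 * c ^ 2 := by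
  have hbp : 60 * b ≤ p := by
    refine (sq_le_sq₀ (by positivity) p0).1 ?_
    linarith [sq_nonneg b]
  have hp2 : p ^ 2 ≤ (60 / 59 * a) ^ 2 := by gcongr; linarith
  have hd2 : d ^ 2 ≤ (a / 59 + c) ^ 2 := by gcongr; linarith
  have hr2 : r ^ 2 ≤ (60 / 59 * a + c) ^ 2 := by gcongr; linarith
  linarith [sq_nonneg (a - c), sq_nonneg a, sq_nonneg c]

/-- One-sided progress of an inexact optimistic proximal step with step size `1 / (4 * L)`:
`xt` is an inexact proximal point of `g₀` at `x`, and `xn` one of `g₁`. -/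
theorem inexact_optimistic_prox_step {E : Type*} [NormedAddCommGroup E] [InnerProductSpace ℝ E]
    {X : Set E} {g₀ g₁ : E → ℝ} {μ L ε D : ℝ} (hμ : 0 < μ) (hμL : μ ≤ L) (hε : ε = μ / 2368)
    (hg₀ : ConvexOn ℝ X (fun z => g₀ z - μ / 2 * ‖z‖ ^ 2))
    (hg₁ : ConvexOn ℝ X (fun z => g₁ z - μ / 2 * ‖z‖ ^ 2))
    {x xt xts xn xns q : E} (hxt : xt ∈ X) (hxts : xts ∈ X) (hxn : xn ∈ X) (hxns : xns ∈ X)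
    (hq : q ∈ X)
    (hcross : (g₁ xt - g₀ xt) - (g₁ xns - g₀ xns) ≤ L * D * ‖xt - xns‖)
    (hmin₀ : IsMinOn (fun z => g₀ z + 2 * L * ‖z - x‖ ^ 2) X xts)
    (hmin₁ : IsMinOn (fun z => g₁ z + 2 * L * ‖z - x‖ ^ 2) X xns)
    (hin₀ : g₀ xt + 2 * L * ‖xt - x‖ ^ 2
      ≤ g₀ xts + 2 * L * ‖xts - x‖ ^ 2 + ε * ‖x - xts‖ ^ 2)
    (hin₁ : g₁ xn + 2 * L * ‖xn - x‖ ^ 2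
      ≤ g₁ xns + 2 * L * ‖xns - x‖ ^ 2 + ε * ‖x - xns‖ ^ 2) :
    (2 * L + μ / 8) * ‖xn - q‖ ^ 2 + (g₁ xt - g₁ q)
      ≤ 2 * L * ‖x - q‖ ^ 2 - L / 2 * ‖xt - x‖ ^ 2 + L / 2 * D ^ 2 := by
  have hL : 0 < L := hμ.trans_le hμL
  have h1 := prox_quadratic_growth hg₁ hxns hq hmin₁
  have h2 := prox_quadratic_growth hg₁ hxns hxn hmin₁
  have h3 := prox_quadratic_growth hg₀ hxts hxns hmin₀
  have h4 := prox_quadratic_growth hg₀ hxts hxt hmin₀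
  have t1 : ‖x - xts‖ ≤ ‖xt - x‖ + ‖xts - xt‖ := by
    rw [norm_sub_rev xt x, norm_sub_rev xts xt]; exact norm_sub_le_norm_sub_add_norm_sub _ _ _
  have t2 : ‖xt - xns‖ ≤ ‖xts - xt‖ + ‖xts - xns‖ := by
    rw [norm_sub_rev xts xt]; exact norm_sub_le_norm_sub_add_norm_sub _ _ _
  have t3 : ‖x - xns‖ ≤ ‖x - xts‖ + ‖xts - xns‖ := norm_sub_le_norm_sub_add_norm_sub _ _ _
  have t4 : ‖xn - q‖ ≤ ‖xns - xn‖ + ‖xns - q‖ := by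
    rw [norm_sub_rev xns xn]; exact norm_sub_le_norm_sub_add_norm_sub _ _ _
  rw [norm_sub_rev q x] at h1
  have e4 : 2 * L * ‖xts - xt‖ ^ 2 ≤ ε * ‖x - xts‖ ^ 2 := by
    nlinarith [mul_nonneg hμ.le (sq_nonneg ‖xts - xt‖)]
  have e2 : 2 * L * ‖xns - xn‖ ^ 2 ≤ ε * ‖x - xns‖ ^ 2 := by
    nlinarith [mul_nonneg hμ.le (sq_nonneg ‖xns - xn‖)]
  have b0 := norm_nonneg (xts - xt)
  have d0 := norm_nonneg (xt - xns)
  have p0 := norm_nonneg (x - xts)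
  have r0 := norm_nonneg (x - xns)
  have k0 := norm_nonneg (xn - q)
  generalize ‖xt - x‖ = a at *
  generalize ‖xts - xt‖ = b at *
  generalize ‖xts - xns‖ = c at *
  generalize ‖xt - xns‖ = d at *
  generalize ‖x - xts‖ = p at *
  generalize ‖x - xns‖ = r at *
  generalize ‖xn - q‖ = k at *
  generalize ‖xns - xn‖ = m at *
  generalize ‖xns - q‖ = n at *
  have dist_bound : (2 * L + μ / 8) * k ^ 2 ≤ (2 * L + μ / 2) * n ^ 2 + L / 10 * r ^ 2 :=
    perturbed_sq_le hμ hμL k0 t4 (by rw [hε] at e2; linarith)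
  have hb : 4736 * b ^ 2 ≤ p ^ 2 := by
    refine le_of_mul_le_mul_left ?_ hL
    rw [hε] at e4
    linarith [mul_le_mul_of_nonneg_right hμL (sq_nonneg p)]
  have hsq := prox_side_lengths_sq_le b0 d0 p0 r0 hb t1 t2 t3
  have hsqL := mul_le_mul_of_nonneg_left hsq hL.le
  have hεp : ε * p ^ 2 ≤ L / 2368 * p ^ 2 := by rw [hε]; gcongr
  have hDd : L * D * d ≤ L / 2 * D ^ 2 + L / 2 * d ^ 2 := by
    linarith [mul_nonneg hL.le (sq_nonneg (D - d))]
  have hμc : 0 ≤ μ / 2 * c ^ 2 := by positivity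
  linarith

/-- **RIODA, unconstrained strongly convex-concave case, Euclidean instance.** Theorem 3.3 of
"Implicit Riemannian Optimism with Applications to Min-Max Problems": linear contraction of
the iterates towards the saddle point, boundedness of all iterates, and last-iterate rate. -/
theorem rioda_unconstrained_strongly_convex_concave
    {E₁ E₂ : Type*}
    [NormedAddCommGroup E₁] [InnerProductSpace ℝ E₁] [FiniteDimensional ℝ E₁]
    [NormedAddCommGroup E₂] [InnerProductSpace ℝ E₂] [FiniteDimensional ℝ E₂]
    (μ L : ℝ) (hμ : 0 < μ) (hμL : μ ≤ L)
    (xstar : E₁) (ystar : E₂)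
    (f : E₁ × E₂ → ℝ) (hdiff : Differentiable ℝ f)
    (R : ℝ) (hR : 0 < R)
    (hconv : ∀ y ∈ Metric.closedBall ystar (8 * R),
      ConvexOn ℝ (Metric.closedBall xstar (8 * R)) (fun x => f (x, y) - μ / 2 * ‖x‖ ^ 2))
    (hconc : ∀ x ∈ Metric.closedBall xstar (8 * R),
      ConvexOn ℝ (Metric.closedBall ystar (8 * R)) (fun y => -f (x, y) - μ / 2 * ‖y‖ ^ 2))
    (hsmooth_xx : ∀ y ∈ Metric.closedBall ystar (8 * R),
      ∀ x ∈ Metric.closedBall xstar (8 * R), ∀ x' ∈ Metric.closedBall xstar (8 * R),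
      ‖gradient (fun z => f (z, y)) x - gradient (fun z => f (z, y)) x'‖ ≤ L * ‖x - x'‖)
    (hsmooth_yy : ∀ x ∈ Metric.closedBall xstar (8 * R),
      ∀ y ∈ Metric.closedBall ystar (8 * R), ∀ y' ∈ Metric.closedBall ystar (8 * R),
      ‖gradient (fun w => f (x, w)) y - gradient (fun w => f (x, w)) y'‖ ≤ L * ‖y - y'‖)
    (hsmooth_xy : ∀ x ∈ Metric.closedBall xstar (8 * R),
      ∀ y ∈ Metric.closedBall ystar (8 * R), ∀ y' ∈ Metric.closedBall ystar (8 * R),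
      ‖gradient (fun z => f (z, y)) x - gradient (fun z => f (z, y')) x‖ ≤ L * ‖y - y'‖)
    (hsmooth_yx : ∀ y ∈ Metric.closedBall ystar (8 * R),
      ∀ x ∈ Metric.closedBall xstar (8 * R), ∀ x' ∈ Metric.closedBall xstar (8 * R),
      ‖gradient (fun w => f (x, w)) y - gradient (fun w => f (x', w)) y‖ ≤ L * ‖x - x'‖)
    (hsaddle : ∀ x ∈ Metric.closedBall xstar (8 * R), ∀ y ∈ Metric.closedBall ystar (8 * R),
      f (xstar, y) ≤ f (xstar, ystar) ∧ f (xstar, ystar) ≤ f (x, ystar))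
    (η : ℝ) (hη : η = 1 / (4 * L))
    (ε : ℕ → ℝ) (hεdef : ∀ t, ε t = L / 8 * min 1 (μ / (296 * L)))
    (T : ℕ) (hT : 0 < T)
    (x xt xts xns : ℕ → E₁) (y yt yts yns : ℕ → E₂)
    (hx1 : x 1 ∈ Metric.closedBall xstar (8 * R)) (hy1 : y 1 ∈ Metric.closedBall ystar (8 * R))
    (hRdef : R = ‖x 1 - xstar‖ + ‖y 1 - ystar‖)
    (hmem : ∀ t ∈ Finset.Icc 1 T, xt t ∈ Metric.closedBall xstar (8 * R)
      ∧ yt t ∈ Metric.closedBall ystar (8 * R)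
      ∧ x (t + 1) ∈ Metric.closedBall xstar (8 * R)
      ∧ y (t + 1) ∈ Metric.closedBall ystar (8 * R))
    (hxts : ∀ t ∈ Finset.Icc 1 T, xts t ∈ Metric.closedBall xstar (8 * R) ∧
      IsMinOn (fun z => f (z, y t) + 1 / (2 * η) * ‖z - x t‖ ^ 2)
        (Metric.closedBall xstar (8 * R)) (xts t))
    (hyts : ∀ t ∈ Finset.Icc 1 T, yts t ∈ Metric.closedBall ystar (8 * R) ∧
      IsMaxOn (fun w => f (x t, w) - 1 / (2 * η) * ‖w - y t‖ ^ 2)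
        (Metric.closedBall ystar (8 * R)) (yts t))
    (hxns : ∀ t ∈ Finset.Icc 1 T, xns (t + 1) ∈ Metric.closedBall xstar (8 * R) ∧
      IsMinOn (fun z => f (z, yt t) + 1 / (2 * η) * ‖z - x t‖ ^ 2)
        (Metric.closedBall xstar (8 * R)) (xns (t + 1)))
    (hyns : ∀ t ∈ Finset.Icc 1 T, yns (t + 1) ∈ Metric.closedBall ystar (8 * R) ∧
      IsMaxOn (fun w => f (xt t, w) - 1 / (2 * η) * ‖w - y t‖ ^ 2)
        (Metric.closedBall ystar (8 * R)) (yns (t + 1)))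
    (hin1 : ∀ t ∈ Finset.Icc 1 T,
      f (xt t, y t) + 1 / (2 * η) * ‖xt t - x t‖ ^ 2
        ≤ f (xts t, y t) + 1 / (2 * η) * ‖xts t - x t‖ ^ 2 + ε t * ‖x t - xts t‖ ^ 2)
    (hin2 : ∀ t ∈ Finset.Icc 1 T,
      -f (x t, yt t) + 1 / (2 * η) * ‖yt t - y t‖ ^ 2
        ≤ -f (x t, yts t) + 1 / (2 * η) * ‖yts t - y t‖ ^ 2 + ε t * ‖y t - yts t‖ ^ 2)
    (hin3 : ∀ t ∈ Finset.Icc 1 T,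
      f (x (t + 1), yt t) + 1 / (2 * η) * ‖x (t + 1) - x t‖ ^ 2
        ≤ f (xns (t + 1), yt t) + 1 / (2 * η) * ‖xns (t + 1) - x t‖ ^ 2
          + ε t * ‖x t - xns (t + 1)‖ ^ 2)
    (hin4 : ∀ t ∈ Finset.Icc 1 T,
      -f (xt t, y (t + 1)) + 1 / (2 * η) * ‖y (t + 1) - y t‖ ^ 2
        ≤ -f (xt t, yns (t + 1)) + 1 / (2 * η) * ‖yns (t + 1) - y t‖ ^ 2
          + ε t * ‖y t - yns (t + 1)‖ ^ 2) :
    (∀ t ∈ Finset.Icc 1 T,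
      ‖x (t + 1) - xstar‖ ^ 2 + ‖y (t + 1) - ystar‖ ^ 2
        ≤ (1 + μ / (16 * L))⁻¹ * (‖x t - xstar‖ ^ 2 + ‖y t - ystar‖ ^ 2))
    ∧ (∀ t ∈ Finset.Icc 1 (T + 1),
        x t ∈ Metric.closedBall xstar (8 * R) ∧ y t ∈ Metric.closedBall ystar (8 * R))
    ∧ (∀ t ∈ Finset.Icc 1 T,
        xt t ∈ Metric.closedBall xstar (8 * R) ∧ yt t ∈ Metric.closedBall ystar (8 * R))
    ∧ (∀ ε' : ℝ, 0 < ε' →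
        (T : ℝ) ≥ 1 + 17 * L / μ * Real.log (2 * L * R ^ 2 / ε') →
        f (xt T, ystar) - f (xstar, yt T) ≤ ε') := by
  have hL : 0 < L := hμ.trans_le hμL
  have hη2 : 1 / (2 * η) = 2 * L := by rw [hη]; field_simp; norm_num
  have hε2 : ∀ t, ε t = μ / 2368 := by
    intro t
    rw [hεdef, min_eq_right]
    · field_simp; norm_num
    · rw [div_le_one (by positivity)]; linarith
  simp only [hη2] at *
  have hxs : xstar ∈ Metric.closedBall xstar (8 * R) := Metric.mem_closedBall_self (by positivity)
  have hys : ystar ∈ Metric.closedBall ystar (8 * R) := Metric.mem_closedBall_self (by positivity)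
  have hmem' : ∀ t ∈ Finset.Icc 1 (T + 1),
      x t ∈ Metric.closedBall xstar (8 * R) ∧ y t ∈ Metric.closedBall ystar (8 * R) := by
    intro t ht
    rw [Finset.mem_Icc] at ht
    obtain rfl | h1 := ht.1.eq_or_lt
    · exact ⟨hx1, hy1⟩
    · have := (hmem (t - 1) (Finset.mem_Icc.2 (by omega))).2.2
      rwa [Nat.sub_add_cancel ht.1] at this
  have step : ∀ t ∈ Finset.Icc 1 T,
      (2 * L + μ / 8) * (‖x (t + 1) - xstar‖ ^ 2 + ‖y (t + 1) - ystar‖ ^ 2)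
        + (f (xt t, ystar) - f (xstar, yt t))
        ≤ 2 * L * (‖x t - xstar‖ ^ 2 + ‖y t - ystar‖ ^ 2) := by
    intro t ht
    obtain ⟨hxt, hyt, hxn, hyn⟩ := hmem t ht
    obtain ⟨hxm, hym⟩ := hmem' t (Finset.Icc_subset_Icc_right (by omega) ht)
    have crossx := sub_sub_sub_le_of_norm_gradient_sub_le_s6 (convex_closedBall xstar (8 * R))
      (g₀ := fun z => f (z, y t)) (g₁ := fun z => f (z, yt t)) (by fun_prop) (by fun_prop)
      (fun z hz => hsmooth_xy z hz _ hyt _ hym) hxt (hxns t ht).1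
    have crossy := sub_sub_sub_le_of_norm_gradient_sub_le_s6 (convex_closedBall ystar (8 * R))
      (g₀ := fun w => f (xt t, w)) (g₁ := fun w => f (x t, w)) (by fun_prop) (by fun_prop)
      (fun w hw => (norm_sub_rev _ _).trans_le (hsmooth_yx w hw _ hxt _ hxm))
      hyt (hyns t ht).1
    have bx := inexact_optimistic_prox_step (g₀ := fun z => f (z, y t))
      (g₁ := fun z => f (z, yt t)) hμ hμL (hε2 t) (hconv _ hym) (hconv _ hyt)
      hxt (hxts t ht).1 hxn (hxns t ht).1 hxs crossx (hxts t ht).2 (hxns t ht).2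
      (hin1 t ht) (hin3 t ht)
    have my₀ : IsMinOn (fun w => -f (x t, w) + 2 * L * ‖w - y t‖ ^ 2)
        (Metric.closedBall ystar (8 * R)) (yts t) := by
      intro w hw
      have := isMaxOn_iff.1 (hyts t ht).2 w hw
      simp only [Set.mem_ofPred_eq]
      linarith
    have my₁ : IsMinOn (fun w => -f (xt t, w) + 2 * L * ‖w - y t‖ ^ 2)
        (Metric.closedBall ystar (8 * R)) (yns (t + 1)) := by
      intro w hw
      have := isMaxOn_iff.1 (hyns t ht).2 w hw
      simp only [Set.mem_ofPred_eq]
      linarith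
    have bY := inexact_optimistic_prox_step (g₀ := fun w => -f (x t, w))
      (g₁ := fun w => -f (xt t, w)) (D := ‖xt t - x t‖) hμ hμL (hε2 t) (hconc _ hxm)
      (hconc _ hxt) hyt (hyts t ht).1 hyn (hyns t ht).1 hys (by linarith) my₀ my₁
      (hin2 t ht) (hin4 t ht)
    linarith
  have gap_nonneg : ∀ t ∈ Finset.Icc 1 T, 0 ≤ f (xt t, ystar) - f (xstar, yt t) := by
    intro t ht
    obtain ⟨hxt, hyt, -⟩ := hmem t ht
    linarith [(hsaddle _ hxs _ hyt).1, (hsaddle _ hxt _ hys).2]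
  have contraction : ∀ t ∈ Finset.Icc 1 T,
      ‖x (t + 1) - xstar‖ ^ 2 + ‖y (t + 1) - ystar‖ ^ 2
        ≤ (1 + μ / (16 * L))⁻¹ * (‖x t - xstar‖ ^ 2 + ‖y t - ystar‖ ^ 2) := by
    intro t ht
    rw [inv_mul_eq_div, le_div_iff₀' (by positivity)]
    refine le_of_mul_le_mul_left ?_ (show 0 < 2 * L by positivity)
    rw [← mul_assoc, show 2 * L * (1 + μ / (16 * L)) = 2 * L + μ / 8 by field_simp; ring]
    linarith [step t ht, gap_nonneg t ht]
  refine ⟨contraction, hmem', fun t ht => ⟨(hmem t ht).1, (hmem t ht).2.1⟩, ?_⟩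
  intro ε' hε' hTε
  have hpow : ∀ n : ℕ, n < T → ‖x (n + 1) - xstar‖ ^ 2 + ‖y (n + 1) - ystar‖ ^ 2
      ≤ (1 + μ / (16 * L))⁻¹ ^ n * R ^ 2 := by
    intro n
    induction n with
    | zero =>
      intro _
      rw [pow_zero, one_mul, zero_add, hRdef]
      nlinarith [mul_nonneg (norm_nonneg (x 1 - xstar)) (norm_nonneg (y 1 - ystar))]
    | succ n ih =>
      intro hn
      refine (contraction (n + 1) (Finset.mem_Icc.2 (by omega))).trans ?_
      rw [pow_succ' (1 + μ / (16 * L))⁻¹, mul_assoc]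
      exact mul_le_mul_of_nonneg_left (ih (by omega)) (by positivity)
  have hTT : T ∈ Finset.Icc 1 T := Finset.mem_Icc.2 ⟨hT, le_rfl⟩
  obtain ⟨n, rfl⟩ : ∃ n, T = n + 1 := ⟨T - 1, by omega⟩
  have hW := hpow n (by omega)
  have hgap := step (n + 1) hTT
  have hlog : Real.log (2 * L * R ^ 2 / ε') ≤ n * Real.log (1 + μ / (16 * L)) := by
    have h1 : μ / (17 * L) ≤ Real.log (1 + μ / (16 * L)) := by
      refine le_trans ?_ (Real.one_sub_inv_le_log_of_pos (by positivity))
      rw [show 1 - (1 + μ / (16 * L))⁻¹ = μ / (16 * L + μ) by field_simp; ring]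
      gcongr
      linarith
    refine le_trans ?_ (mul_le_mul_of_nonneg_left h1 n.cast_nonneg)
    push_cast at hTε
    have h2 : 17 * L / μ * Real.log (2 * L * R ^ 2 / ε') ≤ n := by linarith
    rw [div_mul_eq_mul_div, div_le_iff₀ hμ] at h2
    rw [mul_div_assoc', le_div_iff₀ (by positivity)]
    linarith
  have hexp : 2 * L * R ^ 2 / ε' ≤ (1 + μ / (16 * L)) ^ n := by
    rw [← Real.log_pow] at hlog
    exact (Real.log_le_log_iff (by positivity) (by positivity)).1 hlog
  rw [div_le_iff₀ hε'] at hexp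
  have hfin : 2 * L * ((1 + μ / (16 * L))⁻¹ ^ n * R ^ 2) ≤ ε' := by
    rw [inv_pow, inv_mul_eq_div, mul_div_assoc', div_le_iff₀' (by positivity)]
    exact hexp
  have hmul := mul_le_mul_of_nonneg_left hW (show 0 ≤ 2 * L by positivity)
  have hnn : 0 ≤ (2 * L + μ / 8)
      * (‖x (n + 1 + 1) - xstar‖ ^ 2 + ‖y (n + 1 + 1) - ystar‖ ^ 2) := by positivity
  linarith
end

section
/- Let E₁, E₂ be finite-dimensional real inner product spaces, L > 0 and 0 < η ≤ 1/(4L). Let x_t ∈ E₁, y_t ∈ E₂, x* ∈ E₁, y* ∈ E₂ with S := ‖x_t − x*‖ + ‖y_t − y*‖ > 0, set D̄ := 3S, X̄ := B̄(x*, D̄), Ȳ := B̄(y*, D̄). Let f : E₁ × E₂ → ℝ be differentiable, convex-concave and L-smooth on X̄ × Ȳ, with f(x*, y) ≤ f(x*, y*) ≤ f(x, y*) for all (x, y) ∈ X̄ × Ȳ. Define x̃*_t := argmin_{x∈X̄}{f(x, y_t) + (1/(2η))‖x − x_t‖²} and ỹ*_t := argmax_{y∈Ȳ}{f(x_t, y)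 − (1/(2η))‖y − y_t‖²}. Then (i) ‖x̃*_t − x*‖ + ‖ỹ*_t − y*‖ ≤ (9/4)·S. Moreover, (ii) if x̃_t ∈ X̄ and ỹ_t ∈ Ȳ satisfy ‖x̃_t − x*‖ + ‖ỹ_t − y*‖ ≤ (9/4)·S, then the points x*_{t+1} := argmin_{x∈X̄}{f(x, ỹ_t) + (1/(2η))‖x − x_t‖²} and y*_{t+1} := argmax_{y∈Ȳ}{f(x̃_t, y) − (1/(2η))‖y − y_t‖²} satisfy ‖x*_{t+1} − x*‖ + ‖y*_{t+1} − y*‖ ≤ (41/16)·S. -/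
/-- A proximal point of `g` is no farther from `xstar` than the prox center is, up to `η` times the
distance between the gradient of `g` and that of a convex comparison function `h` that does not
exceed at `xstar` its value at the proximal point. -/
theorem norm_prox_sub_le {E : Type*} [NormedAddCommGroup E] [InnerProductSpace ℝ E]
    [CompleteSpace E] {C : Set E} {g h : E → ℝ} {x x₀ xstar : E} {η M : ℝ} (hη : 0 < η)
    (hM : 0 ≤ M) (hg : DifferentiableAt ℝ g x) (hh : DifferentiableAt ℝ h x)
    (hconv : ConvexOn ℝ C h) (hx : x ∈ C) (hxstar : xstar ∈ C)
    (hmin : IsMinOn (fun z => g z + 1 / (2 * η) * ‖z - x₀‖ ^ 2) C x)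
    (hle : h xstar ≤ h x) (hgrad : ‖gradient g x - gradient h x‖ ≤ M) :
    ‖x - xstar‖ ≤ ‖x₀ - xstar‖ + η * M := by
  have hseg : segment ℝ x xstar ⊆ C := hconv.1.segment_subset hx hxstar
  have hcone : xstar - x ∈ posTangentConeAt (segment ℝ x xstar) x :=
    sub_mem_posTangentConeAt_of_segment_subset subset_rfl
  have hmax : IsMaxOn h (segment ℝ x xstar) x := fun z hz =>
    (hconv.le_on_segment hx hxstar hz).trans (max_le le_rfl hle)
  have hh_dir : inner ℝ (gradient h x) (xstar - x) ≤ 0 := by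
    simpa using hmax.localize.hasFDerivWithinAt_nonpos
      hh.hasGradientAt.hasFDerivAt.hasFDerivWithinAt hcone
  have hsq : HasFDerivAt (fun z => ‖z - x₀‖ ^ 2) (2 • innerSL ℝ (x - x₀)) x := by
    simpa using ((hasFDerivAt_id x).sub_const x₀).norm_sq
  have hg_dir : 0 ≤ inner ℝ (gradient g x) (xstar - x)
      + 1 / (2 * η) * (2 * inner ℝ (x - x₀) (xstar - x)) := by
    simpa [inner_sub_left] using (hmin.on_subset hseg).localize.hasFDerivWithinAt_nonneg
      (hg.hasGradientAt.hasFDerivAt.add (hsq.const_mul (1 / (2 * η)))).hasFDerivWithinAt hcone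
  have hdiff : inner ℝ (gradient g x - gradient h x) (xstar - x) ≤ M * ‖x - xstar‖ := by
    rw [norm_sub_rev x xstar]
    exact (real_inner_le_norm _ _).trans (by gcongr)
  have hcenter : inner ℝ (x₀ - xstar) (x - xstar) ≤ ‖x₀ - xstar‖ * ‖x - xstar‖ :=
    real_inner_le_norm _ _
  have hexpand : inner ℝ (x - x₀) (xstar - x)
      = inner ℝ (x₀ - xstar) (x - xstar) - ‖x - xstar‖ ^ 2 := by
    rw [← real_inner_self_eq_norm_sq, ← inner_sub_left, ← neg_sub x xstar, inner_neg_right,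
      ← inner_neg_left]
    congr 1
    abel
  rw [inner_sub_left] at hdiff
  have hscale : 1 / (2 * η) * (2 * inner ℝ (x - x₀) (xstar - x))
      = inner ℝ (x - x₀) (xstar - x) / η := by
    field_simp
  rw [hscale] at hg_dir
  have hstep : -(M * ‖x - xstar‖) ≤ inner ℝ (x - x₀) (xstar - x) / η := by linarith
  rw [le_div_iff₀ hη] at hstep
  rcases (norm_nonneg (x - xstar)).eq_or_lt with h0 | hpos
  · rw [← h0]
    positivity
  · refine le_of_mul_le_mul_right ?_ hpos
    nlinarith

theorem gradient_neg_eq {E : Type*} [NormedAddCommGroup E] [InnerProductSpace ℝ E]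
    [CompleteSpace E] (g : E → ℝ) (x : E) :
    gradient (fun z => -g z) x = -gradient g x := by
  simp [gradient, fderiv_fun_neg]

/-- **Stability of proximal points around a saddle point, Euclidean instance.**
Proposition D.1 of "Implicit Riemannian Optimism with Applications to Min-Max Problems". -/
theorem prox_points_stability
    {E₁ E₂ : Type*}
    [NormedAddCommGroup E₁] [InnerProductSpace ℝ E₁] [FiniteDimensional ℝ E₁]
    [NormedAddCommGroup E₂] [InnerProductSpace ℝ E₂] [FiniteDimensional ℝ E₂]
    (L : ℝ) (hL : 0 < L) (η : ℝ) (hη : 0 < η) (hηL : η ≤ 1 / (4 * L))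
    (xt xstar : E₁) (yt ystar : E₂)
    (S : ℝ) (hSdef : S = ‖xt - xstar‖ + ‖yt - ystar‖) (hS : 0 < S)
    (f : E₁ × E₂ → ℝ) (hdiff : Differentiable ℝ f)
    (hconv : ∀ y ∈ Metric.closedBall ystar (3 * S),
      ConvexOn ℝ (Metric.closedBall xstar (3 * S)) (fun x => f (x, y)))
    (hconc : ∀ x ∈ Metric.closedBall xstar (3 * S),
      ConcaveOn ℝ (Metric.closedBall ystar (3 * S)) (fun y => f (x, y)))
    (hsmooth_xx : ∀ y ∈ Metric.closedBall ystar (3 * S),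
      ∀ x ∈ Metric.closedBall xstar (3 * S), ∀ x' ∈ Metric.closedBall xstar (3 * S),
      ‖gradient (fun z => f (z, y)) x - gradient (fun z => f (z, y)) x'‖ ≤ L * ‖x - x'‖)
    (hsmooth_yy : ∀ x ∈ Metric.closedBall xstar (3 * S),
      ∀ y ∈ Metric.closedBall ystar (3 * S), ∀ y' ∈ Metric.closedBall ystar (3 * S),
      ‖gradient (fun w => f (x, w)) y - gradient (fun w => f (x, w)) y'‖ ≤ L * ‖y - y'‖)
    (hsmooth_xy : ∀ x ∈ Metric.closedBall xstar (3 * S),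
      ∀ y ∈ Metric.closedBall ystar (3 * S), ∀ y' ∈ Metric.closedBall ystar (3 * S),
      ‖gradient (fun z => f (z, y)) x - gradient (fun z => f (z, y')) x‖ ≤ L * ‖y - y'‖)
    (hsmooth_yx : ∀ y ∈ Metric.closedBall ystar (3 * S),
      ∀ x ∈ Metric.closedBall xstar (3 * S), ∀ x' ∈ Metric.closedBall xstar (3 * S),
      ‖gradient (fun w => f (x, w)) y - gradient (fun w => f (x', w)) y‖ ≤ L * ‖x - x'‖)
    (hsaddle : ∀ x ∈ Metric.closedBall xstar (3 * S), ∀ y ∈ Metric.closedBall ystar (3 * S),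
      f (xstar, y) ≤ f (xstar, ystar) ∧ f (xstar, ystar) ≤ f (x, ystar))
    (xts : E₁) (hxtsmem : xts ∈ Metric.closedBall xstar (3 * S))
    (hxts : IsMinOn (fun z => f (z, yt) + 1 / (2 * η) * ‖z - xt‖ ^ 2)
      (Metric.closedBall xstar (3 * S)) xts)
    (yts : E₂) (hytsmem : yts ∈ Metric.closedBall ystar (3 * S))
    (hyts : IsMaxOn (fun w => f (xt, w) - 1 / (2 * η) * ‖w - yt‖ ^ 2)
      (Metric.closedBall ystar (3 * S)) yts) :
    ‖xts - xstar‖ + ‖yts - ystar‖ ≤ 9 / 4 * S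
    ∧ (∀ xtil ∈ Metric.closedBall xstar (3 * S), ∀ ytil ∈ Metric.closedBall ystar (3 * S),
        ‖xtil - xstar‖ + ‖ytil - ystar‖ ≤ 9 / 4 * S →
        ∀ xnext ∈ Metric.closedBall xstar (3 * S),
          IsMinOn (fun z => f (z, ytil) + 1 / (2 * η) * ‖z - xt‖ ^ 2)
            (Metric.closedBall xstar (3 * S)) xnext →
        ∀ ynext ∈ Metric.closedBall ystar (3 * S),
          IsMaxOn (fun w => f (xtil, w) - 1 / (2 * η) * ‖w - yt‖ ^ 2)
            (Metric.closedBall ystar (3 * S)) ynext →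
        ‖xnext - xstar‖ + ‖ynext - ystar‖ ≤ 41 / 16 * S) := by
  have hxstar : xstar ∈ Metric.closedBall xstar (3 * S) :=
    Metric.mem_closedBall_self (by positivity)
  have hystar : ystar ∈ Metric.closedBall ystar (3 * S) :=
    Metric.mem_closedBall_self (by positivity)
  have hηL' : η * L ≤ 1 / 4 := by
    rw [le_div_iff₀ (by positivity)] at hηL
    linarith
  have prox_x : ∀ y ∈ Metric.closedBall ystar (3 * S), ∀ x ∈ Metric.closedBall xstar (3 * S),
      IsMinOn (fun z => f (z, y) + 1 / (2 * η) * ‖z - xt‖ ^ 2)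
        (Metric.closedBall xstar (3 * S)) x →
      ‖x - xstar‖ ≤ ‖xt - xstar‖ + 1 / 4 * ‖y - ystar‖ := by
    intro y hy x hx hmin
    have key := norm_prox_sub_le hη (by positivity : 0 ≤ L * ‖y - ystar‖)
      (g := fun z => f (z, y)) (h := fun z => f (z, ystar)) (by fun_prop) (by fun_prop)
      (hconv ystar hystar) hx hxstar hmin (hsaddle x hx ystar hystar).2
      (hsmooth_xy x hx y hy ystar hystar)
    have := mul_le_mul_of_nonneg_right hηL' (norm_nonneg (y - ystar))
    linarith
  have prox_y : ∀ x ∈ Metric.closedBall xstar (3 * S), ∀ y ∈ Metric.closedBall ystar (3 * S),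
      IsMaxOn (fun w => f (x, w) - 1 / (2 * η) * ‖w - yt‖ ^ 2)
        (Metric.closedBall ystar (3 * S)) y →
      ‖y - ystar‖ ≤ ‖yt - ystar‖ + 1 / 4 * ‖x - xstar‖ := by
    intro x hx y hy hmax
    have hmin : IsMinOn (fun w => -f (x, w) + 1 / (2 * η) * ‖w - yt‖ ^ 2)
        (Metric.closedBall ystar (3 * S)) y := by
      simpa only [neg_sub', sub_neg_eq_add] using hmax.neg
    have hgrad : ‖gradient (fun w => -f (x, w)) y - gradient (fun w => -f (xstar, w)) y‖
        ≤ L * ‖x - xstar‖ := by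
      rw [gradient_neg_eq, gradient_neg_eq, neg_sub_neg, norm_sub_rev]
      exact hsmooth_yx y hy x hx xstar hxstar
    have key := norm_prox_sub_le hη (by positivity : 0 ≤ L * ‖x - xstar‖)
      (g := fun w => -f (x, w)) (h := fun w => -f (xstar, w)) (by fun_prop) (by fun_prop)
      (hconc xstar hxstar).neg hy hystar hmin
      (neg_le_neg (hsaddle xstar hxstar y hy).1) hgrad
    have := mul_le_mul_of_nonneg_right hηL' (norm_nonneg (x - xstar))
    linarith
  have hxt : xt ∈ Metric.closedBall xstar (3 * S) := by
    rw [mem_closedBall_iff_norm]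
    linarith [norm_nonneg (yt - ystar)]
  have hyt : yt ∈ Metric.closedBall ystar (3 * S) := by
    rw [mem_closedBall_iff_norm]
    linarith [norm_nonneg (xt - xstar)]
  constructor
  · linarith [prox_x yt hyt xts hxtsmem hxts, prox_y xt hxt yts hytsmem hyts]
  · intro xtil hxtil ytil hytil htil xnext hxnext hxmin ynext hynext hymax
    linarith [prox_x ytil hytil xnext hxnext hxmin, prox_y xtil hxtil ynext hynext hymax]
end
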